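/- Assume the Riemann hypothesis. For real x, y ≥ 2 define Λ_{x,y}(n) = Λ(n) for 1 ≤ n ≤ x and Λ_{x,y}(n) = Λ(n) · log(xy/n)/log y for x < n ≤ xy. Then there exist real numbers E₁ and E₂ with |E₁| ≤ 2|B| (√y + 1)/(√(xy) · log y) and |E₂| ≤ (1/9) · ( 1/(x³ − x) + 1/((xy)³ − xy) ) / log y such that Σ_{n ≤ xy} Λ_{x,y}(n)/n = log x − γ + (log y)/2 + E₁ + E₂, where B = (log 4π)/2 − 1 − γ/2. -/

import Mathlib

/-- The constant `B = (log 4π)/2 − 1 − γ/2 = −0.02309…`. -/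
noncomputable def Bconst : ℝ :=
  Real.log (4 * Real.pi) / 2 - 1 - Real.eulerMascheroniConstant / 2

namespace SelbergAux
section
open Complex Filter Topology MeasureTheory HurwitzZeta Set

noncomputable def xi (s : ℂ) : ℂ := s * (s - 1) * completedRiemannZeta₀ s + 1

noncomputable def fm : ℝ → ℝ := fun t =>
  if 1 < t then evenKernel 0 t - 1 else
    if 0 < t ∧ t < 1 then evenKernel 0 t - t ^ (-(1/2) : ℝ) else 0

lemma cosKernel_ge {t : ℝ} (ht : 0 < t) : 1 ≤ cosKernel 0 t := by
  have h := hasSum_nat_cosKernel₀ 0 ht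
  have h2 : 0 ≤ cosKernel (0:ℝ) t - 1 := by
    rw [← h.tsum_eq]
    apply tsum_nonneg
    intro n
    simp
    positivity
  simpa using h2

lemma fm_nonneg (t : ℝ) : 0 ≤ fm t := by
  unfold fm
  split_ifs with h1 h2
  · rw [evenKernel_eq_cosKernel_of_zero]
    linarith [cosKernel_ge (by linarith : 0 < t)]
  · rw [evenKernel_functional_equation, Real.rpow_neg h2.1.le, one_div]
    have := cosKernel_ge (by have := h2.1; positivity : 0 < 1 / t)
    have h3 : 0 < (t ^ ((1:ℝ)/2))⁻¹ := by have := h2.1; positivity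
    nlinarith
  · rfl

lemma f_modif_eq : (hurwitzEvenFEPair 0).f_modif = fun t => (fm t : ℂ) := by
  funext t
  simp only [WeakFEPair.f_modif, Pi.add_apply, Set.indicator_apply, hurwitzEvenFEPair, fm, mem_Ioi, mem_Ioo]
  by_cases h1 : 1 < t
  · have : ¬ (0 < t ∧ t < 1) := by intro h; linarith [h.2]
    simp [h1, not_lt.2 h1.le]
  · by_cases h2 : 0 < t ∧ t < 1
    · simp [h1, h2]
    · simp [h1, h2]

lemma L0_eq (s : ℂ) : completedRiemannZeta₀ s = mellin (fun t => (fm t : ℂ)) (s / 2) / 2 := by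
  rw [← f_modif_eq]; rfl

lemma L0_conv (s : ℂ) : MellinConvergent (fun t => (fm t : ℂ)) s := by
  rw [← f_modif_eq]
  exact (hurwitzEvenFEPair 0).isStrongFEPair_toStrongFEPair.hasMellin s |>.1

noncomputable def NN (σ : ℝ) : ℝ := ∫ t in Ioi (0:ℝ), t ^ (σ / 2 - 1) * fm t

lemma NN_int (σ : ℝ) : IntegrableOn (fun t : ℝ => t ^ (σ / 2 - 1) * fm t) (Ioi 0) := by
  have h := (L0_conv ((σ/2 : ℝ) : ℂ)).norm
  refine h.congr ?_
  filter_upwards [ae_restrict_mem measurableSet_Ioi] with t ht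
  simp only [mem_Ioi] at ht
  rw [norm_smul, norm_cpow_eq_rpow_re_of_pos ht]
  simp [abs_of_nonneg (fm_nonneg t)]

lemma L0_le (z : ℂ) : ‖completedRiemannZeta₀ z‖ ≤ NN z.re / 2 := by
  rw [L0_eq, norm_div, mellin, NN]
  simp only [Complex.norm_ofNat]
  gcongr
  refine (norm_integral_le_integral_norm _).trans (le_of_eq ?_)
  apply setIntegral_congr_fun measurableSet_Ioi
  intro t ht
  simp only [mem_Ioi] at ht
  simp only
  rw [norm_smul, norm_cpow_eq_rpow_re_of_pos ht]
  simp [abs_of_nonneg (fm_nonneg t)]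

lemma L0_real (σ : ℝ) : completedRiemannZeta₀ σ = ((NN σ / 2 : ℝ) : ℂ) := by
  rw [L0_eq, mellin, NN]
  push_cast
  congr 1
  rw [← integral_complex_ofReal]
  apply setIntegral_congr_fun measurableSet_Ioi
  intro t ht
  simp only [mem_Ioi] at ht
  simp only
  push_cast
  rw [Complex.ofReal_cpow ht.le]
  simp

lemma NN_nonneg (σ : ℝ) : 0 ≤ NN σ := by
  apply setIntegral_nonneg measurableSet_Ioi
  intro t ht
  have := fm_nonneg t
  simp only [mem_Ioi] at ht
  positivity

lemma NN_symm (σ : ℝ) : NN (1 - σ) = NN σ := by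
  have h := completedRiemannZeta₀_one_sub σ
  rw [L0_real, show (1 - (σ:ℂ)) = ((1 - σ : ℝ) : ℂ) by push_cast; rfl, L0_real] at h
  have := Complex.ofReal_inj.1 h
  linarith

lemma NN_le {σ a : ℝ} (h1 : σ ≤ a) (h2 : 1 - a ≤ σ) : NN σ ≤ 2 * NN a := by
  have : NN σ ≤ NN a + NN (1 - a) := by
    unfold NN
    rw [← integral_add (NN_int _) (NN_int _)]
    apply setIntegral_mono_on (NN_int _) ((NN_int _).add (NN_int _)) measurableSet_Ioi
    intro t ht
    simp only [mem_Ioi] at ht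
    simp only [Pi.add_apply]
    rw [← add_mul]
    have := fm_nonneg t
    gcongr
    have p1 : 0 < t ^ (a / 2 - 1) := by positivity
    have p2 : 0 < t ^ ((1-a) / 2 - 1) := by positivity
    rcases le_total 1 t with h | h
    · have := Real.rpow_le_rpow_of_exponent_le h (by linarith : σ / 2 - 1 ≤ a / 2 - 1)
      linarith
    · have := Real.rpow_le_rpow_of_exponent_ge ht h (by linarith : (1 - a) / 2 - 1 ≤ σ / 2 - 1)
      linarith
  rw [NN_symm] at this
  linarith

lemma L0_nat : ∃ C : ℝ, 0 < C ∧ ∀ n : ℕ, 1 ≤ n → NN (2 * n : ℝ) ≤ C * (n : ℝ) ^ n := by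
  refine ⟨2 * (∑' k : ℕ, 1 / (k : ℝ) ^ 2) + 2, ?_, ?_⟩
  · have : 0 ≤ (∑' k : ℕ, 1 / (k : ℝ) ^ 2) := tsum_nonneg (fun k => by positivity)
    linarith
  intro n hn
  set Z := (∑' k : ℕ, 1 / (k : ℝ) ^ 2)
  have hZ : 0 ≤ Z := tsum_nonneg (fun k => by positivity)
  have hn' : (1:ℝ) ≤ n := by exact_mod_cast hn
  have h1 := completedRiemannZeta_eq ((2 * n : ℝ) : ℂ)
  rw [completedZeta_eq_tsum_of_one_lt_re (by simp; linarith), L0_real] at h1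
  have h2 : ‖(∑' k : ℕ, 1 / (k : ℂ) ^ (((2 * n : ℝ)) : ℂ))‖ ≤ Z := by
    have hs : Summable (fun k : ℕ => 1 / (k : ℝ) ^ 2) := by
      exact Real.summable_one_div_nat_pow.2 (by norm_num : 1 < 2)
    apply tsum_of_norm_bounded hs.hasSum
    intro k
    rcases Nat.eq_zero_or_pos k with rfl | hk
    · have : ((2 * n : ℝ) : ℂ) ≠ 0 := by
        norm_cast; omega
      simp [Complex.zero_cpow this]
      omega
    · rw [norm_div, norm_one, Complex.norm_natCast_cpow_of_pos hk]
      have hk' : (1:ℝ) ≤ k := by exact_mod_cast hk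
      have h := Real.rpow_le_rpow_of_exponent_le hk' (by linarith : (2:ℝ) ≤ 2 * n)
      simp only [Complex.ofReal_re]
      rw [Real.rpow_two] at h
      gcongr
  have h3 : ‖(Real.pi : ℂ) ^ (-((2 * n : ℝ) : ℂ) / 2)‖ ≤ 1 := by
    rw [norm_cpow_eq_rpow_re_of_pos Real.pi_pos]
    apply Real.rpow_le_one_of_one_le_of_nonpos
    · linarith [Real.pi_gt_three]
    · simp; linarith
  have h4 : ‖Complex.Gamma (((2 * n : ℝ) : ℂ) / 2)‖ ≤ (n:ℝ) ^ n := by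
    obtain ⟨m, rfl⟩ : ∃ m, n = m + 1 := ⟨n - 1, by omega⟩
    have : (((2 * (m+1 : ℕ) : ℝ) : ℂ) / 2) = (m : ℂ) + 1 := by push_cast; ring
    rw [this, Complex.Gamma_nat_eq_factorial]
    simp only [Complex.norm_natCast]
    have h := Nat.factorial_le_pow m
    calc (m.factorial : ℝ) ≤ (m:ℝ) ^ m := by exact_mod_cast h
      _ ≤ ((m + 1 : ℕ) : ℝ) ^ m := by gcongr; simp
      _ ≤ _ := by
        apply pow_le_pow_right₀ (by simp) (by omega)
  have h5 : (1:ℝ) ≤ (n:ℝ)^n := one_le_pow₀ hn'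
  have h6 : ((NN (2 * n) / 2 : ℝ) : ℂ) = (Real.pi : ℂ) ^ (-((2 * n : ℝ) : ℂ) / 2) * Complex.Gamma (((2 * n : ℝ) : ℂ) / 2) * (∑' k : ℕ, 1 / (k : ℂ) ^ (((2 * n : ℝ)) : ℂ)) + ((1 / (2 * n) + 1 / (1 - 2 * n) : ℝ) : ℂ) := by
    rw [h1]; push_cast; ring
  have h7 : NN (2 * n) / 2 ≤ 1 * (n:ℝ)^n * Z + 1 := by
    calc NN (2 * n) / 2 ≤ ‖((NN (2 * n) / 2 : ℝ) : ℂ)‖ := by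
          rw [Complex.norm_real]; exact Real.le_norm_self _
      _ ≤ _ := by
        rw [h6]
        refine (norm_add_le _ _).trans ?_
        rw [norm_mul, norm_mul]
        gcongr
        rw [Complex.norm_real, Real.norm_eq_abs, abs_le]
        have e1 : 0 < 1 / (2 * (n:ℝ)) := by positivity
        have e2 : 1 / (2 * (n:ℝ)) ≤ 1 := by
          rw [div_le_one (by positivity)]; linarith
        have e3 : 1 / (1 - 2 * (n:ℝ)) ≤ 0 := by
          apply div_nonpos_of_nonneg_of_nonpos <;> linarith
        have e4 : -1 ≤ 1 / (1 - 2 * (n:ℝ)) := by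
          rw [le_div_iff_of_neg (by linarith)]; linarith
        constructor <;> linarith
  nlinarith

lemma xi_growth : ∃ M : ℕ → ℝ, (∀ n : ℕ, 1 ≤ n → 0 ≤ M n ∧ ∀ z : ℂ, ‖z‖ ≤ n → ‖xi z‖ ≤ Real.exp (M n)) ∧
    Tendsto (fun n : ℕ => M n / (n : ℝ) ^ 2) atTop (𝓝 0) := by
  obtain ⟨C, hC, h⟩ := L0_nat
  refine ⟨fun n => Real.log (2 * C + 1) + (n + 2) * Real.log n, ?_, ?_⟩
  · intro n hn
    have hn' : (1:ℝ) ≤ n := by exact_mod_cast hn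
    refine ⟨?_, ?_⟩
    · have := Real.log_nonneg hn'
      have := Real.log_nonneg (by linarith : 1 ≤ 2 * C + 1)
      positivity
    intro z hz
    have h1 : ‖completedRiemannZeta₀ z‖ ≤ C * (n:ℝ)^n := by
      have hre := (abs_le.1 (Complex.abs_re_le_norm z))
      have := L0_le z
      have := NN_le (σ := z.re) (a := 2 * n) (by linarith) (by linarith)
      linarith [h n hn]
    have h2 : ‖z - 1‖ ≤ 2 * n := by
      refine (norm_sub_le _ _).trans ?_
      simp; linarith
    have h5 : (1:ℝ) ≤ (n:ℝ)^(n+2) := one_le_pow₀ hn'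
    calc ‖xi z‖ ≤ n * (2 * n) * (C * (n:ℝ)^n) + 1 := by
          unfold xi
          refine (norm_add_le _ _).trans ?_
          rw [norm_mul, norm_mul, norm_one]
          gcongr
      _ ≤ (2 * C + 1) * (n:ℝ)^(n+2) := by
          rw [pow_add] at *
          nlinarith
      _ = _ := by
          rw [Real.exp_add, Real.exp_log (by linarith), mul_comm ((n:ℝ)+2), Real.exp_mul, Real.exp_log (by linarith)]
          norm_cast
  · have hl : Tendsto (fun x : ℝ => Real.log x / x) atTop (𝓝 0) := by
      simpa using Real.isLittleO_log_id_atTop.tendsto_div_nhds_zero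
    have hl' : Tendsto (fun n : ℕ => Real.log n / (n:ℝ)) atTop (𝓝 0) := hl.comp tendsto_natCast_atTop_atTop
    have hi : Tendsto (fun n : ℕ => 1 / (n:ℝ)) atTop (𝓝 0) := tendsto_one_div_atTop_nhds_zero_nat
    have := ((hi.mul hi).const_mul (Real.log (2 * C + 1))).add (hl'.add ((hl'.mul hi).const_mul 2))
    simp only [mul_zero, add_zero] at this
    refine this.congr' ?_
    filter_upwards [eventually_ge_atTop 1] with n hn
    have : (n:ℝ) ≠ 0 := by positivity
    field_simp

end
end SelbergAux

namespace SelbergAux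
section
open Complex Filter Topology MeasureTheory Set

lemma zeros_finite {f : ℂ → ℂ} (hf : Differentiable ℂ f) (hf0 : f 0 = 1) (r : ℝ) :
    (Metric.closedBall (0:ℂ) r ∩ f ⁻¹' {0}).Finite := by
  by_contra hinf
  obtain ⟨x, -, hx⟩ := Set.Infinite.exists_accPt_of_subset_isCompact hinf
    (isCompact_closedBall (0:ℂ) r) Set.inter_subset_left
  rw [accPt_iff_frequently] at hx
  have hA : AnalyticOnNhd ℂ f Set.univ := fun z _ => hf.analyticAt z
  have := hA.eqOn_zero_of_preconnected_of_frequently_eq_zero isPreconnected_univ (mem_univ x) (by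
    rw [frequently_nhdsWithin_iff]
    exact hx.mono (fun y hy => ⟨hy.2.2, hy.1⟩))
  have h0 := this (mem_univ 0)
  simp [hf0] at h0

noncomputable def zeros (f : ℂ → ℂ) (r : ℝ) : Finset ℂ :=
  open scoped Classical in
  if h : (Metric.closedBall (0:ℂ) r ∩ f ⁻¹' {0}).Finite then h.toFinset else ∅

lemma mem_zeros {f : ℂ → ℂ} (hf : Differentiable ℂ f) (hf0 : f 0 = 1) {r : ℝ} {z : ℂ} :
    z ∈ zeros f r ↔ ‖z‖ ≤ r ∧ f z = 0 := by
  simp [zeros, zeros_finite hf hf0 r]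

lemma order_ne_top {f : ℂ → ℂ} (hf : Differentiable ℂ f) (hf0 : f 0 ≠ 0) (a : ℂ) :
    analyticOrderAt f a ≠ ⊤ := by
  have hA : AnalyticOnNhd ℂ f Set.univ := fun z _ => hf.analyticAt z
  apply hA.analyticOrderAt_ne_top_of_isPreconnected isPreconnected_univ (mem_univ 0) (mem_univ a)
  rw [(hf.analyticAt 0).analyticOrderAt_eq_zero.2 hf0]
  simp

lemma factor_one {g : ℂ → ℂ} (hg : Differentiable ℂ g) (hg0 : g 0 ≠ 0) (a : ℂ) :
    ∃ g1 : ℂ → ℂ, Differentiable ℂ g1 ∧ g1 a ≠ 0 ∧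
      ∀ z, g z = (z - a) ^ (analyticOrderNatAt g a) * g1 z := by
  have h := (hg.analyticAt a).analyticOrderAt_eq_natCast.1
    (Nat.cast_analyticOrderNatAt (order_ne_top hg hg0 a)).symm
  obtain ⟨h, hh, hha, hev⟩ := h
  set n := analyticOrderNatAt g a
  classical
  set g1 : ℂ → ℂ := fun z => if z = a then h a else g z / (z - a) ^ n with hg1
  have e1 : g1 =ᶠ[𝓝 a] h := by
    filter_upwards [hev] with z hz
    by_cases hza : z = a
    · simp [hg1, hza]
    · have : z - a ≠ 0 := sub_ne_zero.2 hza
      simp only [hg1, hza, if_false, hz, smul_eq_mul]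
      field_simp
  refine ⟨g1, ?_, by simpa [hg1] using hha, ?_⟩
  · intro z
    by_cases hza : z = a
    · rw [hza]
      exact hh.differentiableAt.congr_of_eventuallyEq e1
    · have e2 : g1 =ᶠ[𝓝 z] fun z => g z / (z - a) ^ n := by
        filter_upwards [isOpen_ne.mem_nhds hza] with w hw
        have hw' : w ≠ a := hw
        simp [hg1, hw']
      refine DifferentiableAt.congr_of_eventuallyEq ?_ e2
      have : (z - a) ^ n ≠ 0 := pow_ne_zero _ (sub_ne_zero.2 hza)
      have := hg z
      fun_prop (disch := assumption)
  · intro z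
    by_cases hza : z = a
    · have := hev.self_of_nhds
      simp only [hza, smul_eq_mul] at this ⊢
      rw [this]; simp [hg1]
    · have : z - a ≠ 0 := sub_ne_zero.2 hza
      simp only [hg1, hza, if_false]
      field_simp

lemma factor {f : ℂ → ℂ} (hf : Differentiable ℂ f) (hf0 : f 0 = 1) (Z : Finset ℂ) (hZ : (0:ℂ) ∉ Z) :
    ∃ g : ℂ → ℂ, Differentiable ℂ g ∧ (∀ ρ ∈ Z, g ρ ≠ 0) ∧
      ∀ z, f z = (∏ ρ ∈ Z, (1 - z / ρ) ^ (analyticOrderNatAt f ρ)) * g z := by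
  classical
  induction Z using Finset.induction_on with
  | empty => exact ⟨f, hf, by simp, by simp⟩
  | insert a Z ha ih =>
    have ha0 : a ≠ 0 := by rintro rfl; simp at hZ
    obtain ⟨g, hg, hgZ, hfg⟩ := ih (by intro h; exact hZ (Finset.mem_insert_of_mem h))
    have hg0 : g 0 ≠ 0 := by
      intro h
      have := hfg 0
      simp [h, hf0] at this
    obtain ⟨g1, hg1, hg1a, hgg1⟩ := factor_one hg hg0 a
    have hord : analyticOrderNatAt f a = analyticOrderNatAt g a := by
      have e : f = (fun z => ∏ ρ ∈ Z, (1 - z / ρ) ^ (analyticOrderNatAt f ρ)) * g := by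
        funext z; simp [hfg z]
      have hP : AnalyticAt ℂ (fun z : ℂ => ∏ ρ ∈ Z, (1 - z / ρ) ^ (analyticOrderNatAt f ρ)) a := by
        apply Differentiable.analyticAt
        fun_prop
      have hPa : (∏ ρ ∈ Z, (1 - a / ρ) ^ (analyticOrderNatAt f ρ)) ≠ 0 := by
        rw [Finset.prod_ne_zero_iff]
        intro ρ hρ
        apply pow_ne_zero
        have hρ0 : ρ ≠ 0 := by rintro rfl; exact hZ (Finset.mem_insert_of_mem hρ)
        intro h
        have : a = ρ := by field_simp at h; linear_combination -h
        exact ha (this ▸ hρ)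
      have := analyticOrderAt_mul hP (hg.analyticAt a)
      rw [← e, hP.analyticOrderAt_eq_zero.2 hPa, zero_add] at this
      simp [analyticOrderNatAt, this]
    set n := analyticOrderNatAt g a
    refine ⟨fun z => (-a) ^ n * g1 z, by fun_prop, ?_, ?_⟩
    · intro ρ hρ
      have han : (-a) ^ n ≠ 0 := pow_ne_zero _ (neg_ne_zero.2 ha0)
      rcases Finset.mem_insert.1 hρ with rfl | h
      · exact mul_ne_zero han hg1a
      · refine mul_ne_zero han ?_
        intro h0
        apply hgZ ρ h
        rw [hgg1, h0, mul_zero]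
    · intro z
      rw [Finset.prod_insert ha, hord, hfg z, hgg1 z]
      have : (z - a) ^ n = (1 - z / a) ^ n * (-a) ^ n := by
        rw [← mul_pow]; congr 1; field_simp; ring
      rw [this]; ring

lemma logDeriv_bound {g : ℂ → ℂ} (hg : Differentiable ℂ g) (hg0 : g 0 = 1) {R M : ℝ} (hR : 0 < R)
    (hM : 0 < M) (hne : ∀ z ∈ Metric.ball (0:ℂ) R, g z ≠ 0)
    (hb : ∀ z ∈ Metric.ball (0:ℂ) R, ‖g z‖ ≤ Real.exp M) {s : ℂ} (hs : ‖s‖ ≤ R / 8) :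
    ‖logDeriv g s - logDeriv g 0‖ ≤ 64 * M / R ^ 2 * ‖s‖ := by
  have hd : DifferentiableOn ℂ (logDeriv g) (Metric.ball 0 R) := by
    intro z hz
    have h1 : DifferentiableAt ℂ (deriv g) z := (hg.analyticAt z).deriv.differentiableAt
    exact (h1.div (hg z) (hne z hz)).differentiableWithinAt
  obtain ⟨h0, hh0⟩ := hd.isExactOn_ball
  set h : ℂ → ℂ := fun z => h0 z - h0 0
  have hh : ∀ z ∈ Metric.ball (0:ℂ) R, HasDerivAt h (logDeriv g z) z := fun z hz =>
    (hh0 z hz).sub_const _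
  have h00 : h 0 = 0 := by simp [h]
  have hexp : ∀ z ∈ Metric.ball (0:ℂ) R, g z = cexp (h z) := by
    intro z hz
    have hk : ∀ w ∈ Metric.ball (0:ℂ) R, HasDerivAt (fun w => g w * cexp (- h w)) 0 w := by
      intro w hw
      have := (hg w).hasDerivAt.mul ((hh w hw).neg.cexp)
      refine this.congr_deriv ?_
      have := hne w hw
      rw [show logDeriv g w = deriv g w / g w from rfl]
      field_simp
      simp
    have hc := IsOpen.is_const_of_deriv_eq_zero Metric.isOpen_ball (convex_ball (0:ℂ) R).isPreconnected
      (f := fun w => g w * cexp (- h w))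
      (fun w hw => (hk w hw).differentiableAt.differentiableWithinAt)
      (fun w hw => (hk w hw).deriv) hz (Metric.mem_ball_self hR)
    simp only [h00, hg0, neg_zero, Complex.exp_zero, mul_one] at hc
    rw [Complex.exp_neg] at hc
    have := Complex.exp_ne_zero (h z)
    field_simp at hc
    exact hc
  have hdh : DifferentiableOn ℂ h (Metric.ball 0 R) := fun z hz =>
    (hh z hz).differentiableAt.differentiableWithinAt
  have hbd : ∀ z ∈ Metric.closedBall (0:ℂ) (R/2), ‖h z‖ ≤ 2 * M := by
    intro z hz
    simp only [Metric.mem_closedBall, dist_zero_right] at hz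
    have hzR : z ∈ Metric.ball (0:ℂ) R := by simp; linarith
    have := Complex.borelCaratheodory_zero hM hdh (by
      intro w hw
      have h1 := hb w hw
      rw [hexp w hw, Complex.norm_exp] at h1
      exact Real.exp_le_exp.1 h1) hR hzR h00
    refine this.trans ?_
    rw [div_le_iff₀ (by linarith)]
    nlinarith
  have hderiv : ∀ z ∈ Metric.ball (0:ℂ) R, deriv h z = logDeriv g z := fun z hz => (hh z hz).deriv
  have hsR : s ∈ Metric.ball (0:ℂ) R := by simp; linarith
  rw [← hderiv s hsR, ← hderiv 0 (Metric.mem_ball_self hR)]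
  have := Convex.norm_image_sub_le_of_norm_deriv_le (f := deriv h) (s := Metric.closedBall (0:ℂ) (R/8))
    (C := 64 * M / R ^ 2) (x := 0) (y := s) ?_ ?_ (convex_closedBall _ _) (by simp; linarith) (by simpa using hs)
  · simpa using this
  · intro x hx
    have hxR : x ∈ Metric.ball (0:ℂ) R := by simp at hx ⊢; linarith
    exact (hdh.analyticAt (Metric.isOpen_ball.mem_nhds hxR)).deriv.differentiableAt
  · intro x hx
    simp only [Metric.mem_closedBall, dist_zero_right] at hx
    have hsub : Metric.closedBall x (R/4) ⊆ Metric.closedBall (0:ℂ) (R/2) := by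
      apply Metric.closedBall_subset_closedBall'
      simp; linarith
    have hsub2 : Metric.closedBall (0:ℂ) (R/2) ⊆ Metric.ball 0 R :=
      Metric.closedBall_subset_ball (by linarith)
    have h4 : 0 < R / 4 := by linarith
    have := Complex.norm_iteratedDeriv_le_of_forall_mem_sphere_norm_le (f := h) (c := x) (R := R/4)
      (C := 2 * M) 2 h4
      ((hdh.mono (hsub.trans hsub2)).diffContOnCl_ball (le_refl _)) 
      (fun z hz => hbd z (hsub (Metric.sphere_subset_closedBall hz)))
    rw [iteratedDeriv_succ, iteratedDeriv_one] at this
    refine this.trans (le_of_eq ?_)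
    simp [Nat.factorial]
    field_simp
    ring

theorem PF {f : ℂ → ℂ} (hf : Differentiable ℂ f) (hf0 : f 0 = 1) {M : ℕ → ℝ}
    (hM : ∀ n : ℕ, 1 ≤ n → 0 ≤ M n ∧ ∀ z : ℂ, ‖z‖ ≤ n → ‖f z‖ ≤ Real.exp (M n))
    (hlim : Tendsto (fun n : ℕ => M n / (n : ℝ) ^ 2) atTop (𝓝 0)) {s : ℂ} (hs : f s ≠ 0) :
    Tendsto (fun n : ℕ => ∑ ρ ∈ zeros f (n / 3 : ℝ), (analyticOrderNatAt f ρ : ℂ) * (1 / (s - ρ) + 1 / ρ))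
      atTop (𝓝 (logDeriv f s - logDeriv f 0)) := by
  have key : ∀ᶠ n : ℕ in atTop, ‖(∑ ρ ∈ zeros f (n / 3 : ℝ), (analyticOrderNatAt f ρ : ℂ) * (1 / (s - ρ) + 1 / ρ))
      - (logDeriv f s - logDeriv f 0)‖ ≤ (576 * ‖s‖) * ((M n) / (n:ℝ)^2 + (1 / (n:ℝ)) * (1 / (n:ℝ))) := by
    filter_upwards [eventually_ge_atTop 1, (tendsto_natCast_atTop_atTop (R := ℝ)).eventually_ge_atTop (24 * ‖s‖)] with n hn hsn
    have hn' : (1:ℝ) ≤ n := by exact_mod_cast hn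
    obtain ⟨hM0, hMn⟩ := hM n hn
    set Z := zeros f (n / 3 : ℝ) with hZdef
    have hZ : ∀ ρ, ρ ∈ Z ↔ ‖ρ‖ ≤ n / 3 ∧ f ρ = 0 := fun ρ => mem_zeros hf hf0
    have hZ0 : (0:ℂ) ∉ Z := by simp [hZ, hf0]
    obtain ⟨g, hg, hgZ, hfg⟩ := factor hf hf0 Z hZ0
    have hg0 : g 0 = 1 := by
      have := hfg 0
      simpa [hf0] using this.symm
    have hgne : ∀ z ∈ Metric.ball (0:ℂ) (n/3), g z ≠ 0 := by
      intro z hz h0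
      have hz' : z ∈ Z := by
        rw [hZ]
        refine ⟨by simpa using (Metric.mem_ball.1 hz).le, ?_⟩
        rw [hfg, h0, mul_zero]
      exact hgZ z hz' h0
    have hgb : ∀ z ∈ Metric.closedBall (0:ℂ) n, ‖g z‖ ≤ Real.exp (M n + 1) := by
      intro z hz
      have hpos : (0:ℝ) < n := by linarith
      refine Complex.norm_le_of_forall_mem_frontier_norm_le (U := Metric.ball (0:ℂ) n) Metric.isBounded_ball
        hg.diffContOnCl ?_ (by rwa [closure_ball _ hpos.ne'])
      intro w hw
      rw [frontier_ball _ hpos.ne'] at hw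
      have hwn : ‖w‖ = n := by simpa using hw
      have h1 := hMn w hwn.le
      rw [hfg w, norm_mul, norm_prod] at h1
      have h2 : 1 ≤ ∏ ρ ∈ Z, ‖(1 - w / ρ) ^ (analyticOrderNatAt f ρ)‖ := by
        apply Finset.one_le_prod
        intro ρ hρ
        rw [norm_pow]
        apply one_le_pow₀
        have hρ' := ((hZ ρ).1 hρ).1
        have hρ0 : ρ ≠ 0 := by rintro rfl; exact hZ0 hρ
        have hρp : 0 < ‖ρ‖ := norm_pos_iff.2 hρ0
        have : 3 ≤ ‖w / ρ‖ := by
          rw [norm_div, le_div_iff₀ hρp, hwn]; linarith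
        have h3 := norm_sub_norm_le (w / ρ) 1
        rw [norm_sub_rev, norm_one] at h3
        linarith
      have h3 : ‖g w‖ ≤ Real.exp (M n) := by
        refine le_trans ?_ h1
        exact le_mul_of_one_le_left (norm_nonneg _) h2
      exact h3.trans (Real.exp_le_exp.2 (by linarith))
    have hb := logDeriv_bound hg hg0 (R := n / 3) (M := M n + 1) (by linarith) (by linarith) hgne
      (fun z hz => hgb z (by
        have := Metric.mem_ball.1 hz
        simp at this ⊢; linarith)) (s := s) (by linarith)
    have hld : ∀ z, f z ≠ 0 → logDeriv f z = ∑ ρ ∈ Z, (analyticOrderNatAt f ρ : ℂ) * (1 / (z - ρ)) + logDeriv g z := by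
      intro z hz
      have hz' := hz
      rw [hfg z] at hz'
      have hP := left_ne_zero_of_mul hz'
      have hgz := right_ne_zero_of_mul hz'
      rw [show f = fun z => (∏ ρ ∈ Z, (1 - z / ρ) ^ (analyticOrderNatAt f ρ)) * g z from funext hfg]
      rw [logDeriv_mul z hP hgz (by fun_prop) (hg z)]
      congr 1
      · rw [logDeriv_prod (Finset.prod_ne_zero_iff.1 hP) (by intros; fun_prop)]
        simp only [← hfg]
        apply Finset.sum_congr rfl
        intro ρ hρ
        have hρ0 : ρ ≠ 0 := by rintro rfl; exact hZ0 hρ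
        have hzρ : z - ρ ≠ 0 := by
          intro h
          rw [sub_eq_zero] at h
          exact hz (h ▸ ((hZ ρ).1 hρ).2)
        rw [logDeriv_fun_pow (by fun_prop)]
        congr 1
        rw [logDeriv_apply]
        have hd : HasDerivAt (fun z : ℂ => 1 - z / ρ) (-(1 / ρ)) z := by
          simpa using ((hasDerivAt_id z).div_const ρ).const_sub 1
        rw [hd.deriv]
        have : 1 - z / ρ ≠ 0 := by
          intro h; apply hzρ; field_simp at h; linear_combination -h
        have h3 : ρ - z ≠ 0 := by intro h; apply hzρ; linear_combination -h
        field_simp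
        ring
    have e : (∑ ρ ∈ Z, (analyticOrderNatAt f ρ : ℂ) * (1 / (s - ρ) + 1 / ρ)) - (logDeriv f s - logDeriv f 0)
        = -(logDeriv g s - logDeriv g 0) := by
      rw [hld s hs, hld 0 (by simp [hf0])]
      have : ∑ ρ ∈ Z, (analyticOrderNatAt f ρ : ℂ) * (1 / (s - ρ) + 1 / ρ) =
        ∑ ρ ∈ Z, (analyticOrderNatAt f ρ : ℂ) * (1 / (s - ρ)) - ∑ ρ ∈ Z, (analyticOrderNatAt f ρ : ℂ) * (1 / (0 - ρ)) := by
        rw [← Finset.sum_sub_distrib]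
        apply Finset.sum_congr rfl
        intro ρ hρ
        rw [zero_sub, div_neg]; ring
      rw [this]; ring
    rw [e, norm_neg]
    refine hb.trans (le_of_eq ?_)
    field_simp
    ring
  rw [tendsto_iff_norm_sub_tendsto_zero]
  have hi : Tendsto (fun n : ℕ => 1 / (n:ℝ)) atTop (𝓝 0) := tendsto_one_div_atTop_nhds_zero_nat
  have := (hlim.add (hi.mul hi)).const_mul (576 * ‖s‖)
  simp only [mul_zero, add_zero] at this
  exact squeeze_zero' (Eventually.of_forall fun _ => norm_nonneg _) key this

end
end SelbergAux

namespace SelbergAux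
section
open Complex Filter Topology MeasureTheory Set

lemma xi_diff : Differentiable ℂ xi := by
  unfold xi
  have := differentiable_completedZeta₀
  fun_prop

lemma xi_zero : xi 0 = 1 := by simp [xi]
lemma xi_one : xi 1 = 1 := by simp [xi]
lemma xi_symm (s : ℂ) : xi (1 - s) = xi s := by
  simp only [xi, completedRiemannZeta₀_one_sub]; ring

lemma xi_eq {s : ℂ} (h0 : s ≠ 0) (h1 : s ≠ 1) : xi s = s * (s - 1) * completedRiemannZeta s := by
  rw [completedRiemannZeta_eq, xi]
  have : 1 - s ≠ 0 := sub_ne_zero.2 h1.symm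
  field_simp
  ring

lemma xi_eq' {s : ℂ} (h0 : 0 < s.re) (h1 : s ≠ 1) : xi s = s * (s - 1) * (Gammaℝ s * riemannZeta s) := by
  have hs : s ≠ 0 := by rintro rfl; simp at h0
  rw [xi_eq hs h1, riemannZeta_def_of_ne_zero hs]
  have := Gammaℝ_ne_zero_of_re_pos h0
  field_simp

lemma xi_zero_re (RH : RiemannHypothesis) {ρ : ℂ} (h : xi ρ = 0) : ρ.re = 1 / 2 := by
  have h0 : ρ ≠ 0 := by rintro rfl; simp [xi_zero] at h
  have h1 : ρ ≠ 1 := by rintro rfl; simp [xi_one] at h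
  rw [xi_eq h0 h1] at h
  have hc : completedRiemannZeta ρ = 0 := by
    rcases mul_eq_zero.1 h with h | h
    · rcases mul_eq_zero.1 h with h | h
      · exact absurd h h0
      · exact absurd (sub_eq_zero.1 h) h1
    · exact h
  apply RH ρ
  · rw [riemannZeta_def_of_ne_zero h0, hc, zero_div]
  · rintro ⟨n, hn⟩
    rw [← completedRiemannZeta_one_sub] at hc
    have hre : (1 - ρ).re = 3 + 2 * n := by rw [hn]; simp; ring
    have hp : (0:ℝ) ≤ n := Nat.cast_nonneg n
    have h2 : 1 - ρ ≠ 0 := by intro h; rw [h] at hre; simp at hre; linarith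
    have h3 : riemannZeta (1 - ρ) = 0 := by rw [riemannZeta_def_of_ne_zero h2, hc, zero_div]
    exact riemannZeta_ne_zero_of_one_le_re (by linarith) h3
  · exact h1

/-- `(s-1) ζ(s)` extended to `1`. -/
noncomputable def eta (s : ℂ) : ℂ := Function.update (fun s => (s - 1) * riemannZeta s) 1 1 s

lemma eta_of_ne {s : ℂ} (h : s ≠ 1) : eta s = (s - 1) * riemannZeta s := by
  simp [eta, Function.update, h]

lemma eta_one : eta 1 = 1 := by simp [eta]

lemma hasDerivAt_eta_one : HasDerivAt eta (Real.eulerMascheroniConstant : ℂ) 1 := by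
  rw [hasDerivAt_iff_tendsto_slope]
  refine tendsto_riemannZeta_sub_one_div.congr' ?_
  filter_upwards [self_mem_nhdsWithin] with s hs
  have hs : s ≠ 1 := hs
  have : s - 1 ≠ 0 := sub_ne_zero.2 hs
  rw [slope_def_field, eta_of_ne hs, eta_one]
  field_simp

lemma xi_eta {s : ℂ} (h0 : 0 < s.re) : xi s = s * Gammaℝ s * eta s := by
  by_cases h : s = 1
  · subst h; simp [xi_one, eta_one]
  · rw [xi_eq' h0 h, eta_of_ne h]; ring

lemma eventually_re {s : ℂ} (hs : 0 < s.re) : ∀ᶠ z in 𝓝 s, 0 < z.re :=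
  continuous_re.continuousAt.eventually (lt_mem_nhds hs)

lemma logDeriv_xi_one : logDeriv xi 1 = -(Bconst : ℂ) := by
  have h1 : HasDerivAt xi _ 1 := (((hasDerivAt_id (1:ℂ)).mul hasDerivAt_Gammaℝ_one).mul hasDerivAt_eta_one).congr_of_eventuallyEq
    (by
      filter_upwards [eventually_re (s := 1) (by simp)] with z hz
      simp [xi_eta hz])
  rw [logDeriv_apply, h1.deriv, xi_one, Bconst]
  simp [Gammaℝ_one, eta_one]
  push_cast
  rw [Complex.ofReal_log (by positivity)]
  push_cast
  ring

lemma logDeriv_xi_zero : logDeriv xi 0 = (Bconst : ℂ) := by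
  have h : HasDerivAt (fun s => xi (1 - s)) (deriv xi 1 * (-1)) 0 := by
    have h1 : HasDerivAt (fun s : ℂ => 1 - s) (-1) 0 := by
      simpa using (hasDerivAt_id (0:ℂ)).const_sub 1
    have h2 : HasDerivAt xi (deriv xi 1) ((fun s : ℂ => 1 - s) 0) := by
      simpa using (xi_diff 1).hasDerivAt
    exact h2.comp 0 h1
  simp only [xi_symm] at h
  have h1 := logDeriv_xi_one
  rw [logDeriv_apply, xi_one] at h1
  rw [logDeriv_apply, xi_zero]
  change deriv xi 0 / 1 = _
  have : deriv xi 0 = deriv xi 1 * (-1) := h.deriv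
  rw [this]
  rw [div_one] at h1
  rw [h1]; simp

/-- zeros -/
def Zt : Type := {ρ : ℂ // xi ρ = 0}

lemma mem_zeros_xi {r : ℝ} {z : ℂ} : z ∈ zeros xi r ↔ ‖z‖ ≤ r ∧ xi z = 0 := mem_zeros xi_diff xi_zero

open scoped Classical in
noncomputable def ZF (n : ℕ) : Finset Zt := Finset.subtype (fun ρ => xi ρ = 0) (zeros xi (n / 3 : ℝ))

lemma mem_ZF {n : ℕ} {ρ : Zt} : ρ ∈ ZF n ↔ ‖ρ.1‖ ≤ n / 3 := by
  have : ρ ∈ ZF n ↔ ρ.1 ∈ zeros xi (n / 3 : ℝ) := by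
    unfold ZF
    exact Finset.mem_subtype
  rw [this, mem_zeros_xi]
  simp [ρ.2]

lemma exists_ZF (ρ : Zt) : ∃ n, ρ ∈ ZF n := by
  obtain ⟨n, hn⟩ := exists_nat_ge (3 * ‖ρ.1‖)
  exact ⟨n, mem_ZF.2 (by linarith)⟩

instance : Countable Zt := by
  have h : (⋃ n, (ZF n : Set Zt)) = Set.univ := by
    ext ρ
    simpa using exists_ZF ρ
  rw [← Set.countable_univ_iff, ← h]
  exact Set.countable_iUnion fun n => (ZF n).countable_toSet

lemma ZF_tendsto : Tendsto ZF atTop atTop := by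
  refine tendsto_atTop_finset_of_monotone ?_ exists_ZF
  intro a b hab ρ hρ
  rw [mem_ZF] at *
  have : (a:ℝ) ≤ b := by exact_mod_cast hab
  linarith

noncomputable def mm (ρ : Zt) : ℝ := analyticOrderNatAt xi ρ.1

lemma mm_nonneg (ρ : Zt) : 0 ≤ mm ρ := Nat.cast_nonneg _

lemma PFxi {s : ℂ} (hs : xi s ≠ 0) :
    Tendsto (fun n : ℕ => ∑ ρ ∈ ZF n, (mm ρ : ℂ) * (1 / (s - ρ.1) + 1 / ρ.1)) atTop
      (𝓝 (logDeriv xi s - logDeriv xi 0)) := by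
  obtain ⟨M, hM, hlim⟩ := xi_growth
  refine (PF xi_diff xi_zero hM hlim hs).congr ?_
  intro n
  unfold ZF
  rw [← Finset.sum_subtype_of_mem (p := fun ρ => xi ρ = 0) _ (fun x hx => (mem_zeros_xi.1 hx).2)]
  refine Finset.sum_congr rfl fun x hx => ?_
  simp [mm]

lemma Zt_ne_zero (ρ : Zt) : ρ.1 ≠ 0 := by
  intro h; have := ρ.2; rw [h, xi_zero] at this; exact one_ne_zero this

lemma one_sub_eq (RH : RiemannHypothesis) (ρ : Zt) : 1 - ρ.1 = (starRingEnd ℂ) ρ.1 := by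
  have := xi_zero_re RH ρ.2
  apply Complex.ext
  · simp [this]; norm_num
  · simp

lemma norm_one_sub (RH : RiemannHypothesis) (ρ : Zt) : ‖1 - ρ.1‖ = ‖ρ.1‖ := by
  rw [one_sub_eq RH]; simp

noncomputable def aa (ρ : Zt) : ℝ := mm ρ / ‖ρ.1‖ ^ 2

lemma aa_nonneg (ρ : Zt) : 0 ≤ aa ρ := div_nonneg (mm_nonneg ρ) (by positivity)

lemma hasSum_aa (RH : RiemannHypothesis) : HasSum aa (-2 * Bconst) := by
  have h := PFxi (s := 1) (by simp [xi_one])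
  rw [logDeriv_xi_one, logDeriv_xi_zero] at h
  have h2 : Tendsto (fun n => ∑ ρ ∈ ZF n, aa ρ) atTop (𝓝 (-2 * Bconst)) := by
    have h3 := (continuous_re.tendsto _).comp h
    have e : (-(Bconst:ℂ) - Bconst).re = -2 * Bconst := by simp; ring
    rw [e] at h3
    refine h3.congr fun n => ?_
    simp only [Function.comp, re_sum]
    refine Finset.sum_congr rfl fun ρ _ => ?_
    have h0 := Zt_ne_zero ρ
    have h1 : 1 - ρ.1 ≠ 0 := by
      rw [one_sub_eq RH]; simpa using h0
    have : (1 / (1 - ρ.1) + 1 / ρ.1) = ((1 / ‖ρ.1‖ ^ 2 : ℝ) : ℂ) := by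
      rw [div_add_div _ _ h1 h0]
      have : (1 - ρ.1) * ρ.1 = ((‖ρ.1‖ ^ 2 : ℝ) : ℂ) := by
        rw [one_sub_eq RH, mul_comm, Complex.mul_conj, Complex.normSq_eq_norm_sq]
      rw [this]; push_cast; ring
    rw [this, ← Complex.ofReal_mul, Complex.ofReal_re, aa]
    ring
  have hmono : Monotone fun n => ∑ ρ ∈ ZF n, aa ρ := by
    intro a b hab
    apply Finset.sum_le_sum_of_subset_of_nonneg
    · intro ρ hρ
      rw [mem_ZF] at *
      have : (a:ℝ) ≤ b := by exact_mod_cast hab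
      linarith
    · intros; exact aa_nonneg _
  have hs : Summable aa := by
    refine summable_of_sum_le aa_nonneg (c := -2 * Bconst) fun F => ?_
    obtain ⟨n, hn⟩ := (ZF_tendsto.eventually (eventually_ge_atTop F)).exists
    exact (Finset.sum_le_sum_of_subset_of_nonneg hn fun _ _ _ => aa_nonneg _).trans (hmono.ge_of_tendsto h2 n)
  have := hs.hasSum
  rwa [tendsto_nhds_unique (this.comp ZF_tendsto) h2] at this

lemma norm_add_ge (RH : RiemannHypothesis) (ρ : Zt) {w : ℝ} (hw : 0 ≤ w) : ‖ρ.1‖ ≤ ‖(w:ℂ) + 1 - ρ.1‖ := by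
  rw [← norm_one_sub RH]
  have := xi_zero_re RH ρ.2
  rw [← sq_le_sq₀ (norm_nonneg _) (norm_nonneg _), ← normSq_eq_norm_sq, ← normSq_eq_norm_sq, normSq_apply, normSq_apply]
  simp [this]
  nlinarith

lemma xi_ne (RH : RiemannHypothesis) {w : ℝ} (hw : 0 ≤ w) : xi (w + 1) ≠ 0 := by
  intro h
  have := xi_zero_re RH h
  simp at this
  linarith

lemma PFsum (RH : RiemannHypothesis) {w : ℝ} (hw : 0 ≤ w) :
    HasSum (fun ρ : Zt => (mm ρ : ℂ) * (1 / (w + 1 - ρ.1) - 1 / (1 - ρ.1))) 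
      (logDeriv xi (w + 1) - logDeriv xi 1) := by
  have h1 := PFxi (xi_ne RH hw)
  have h2 := PFxi (s := 1) (by simp [xi_one])
  have h3 := h1.sub h2
  have hs : Summable (fun ρ : Zt => (mm ρ : ℂ) * (1 / (w + 1 - ρ.1) - 1 / (1 - ρ.1))) := by
    refine Summable.of_norm_bounded ((hasSum_aa RH).summable.mul_left w) fun ρ => ?_
    have h0 : 0 < ‖ρ.1‖ := norm_pos_iff.2 (Zt_ne_zero ρ)
    have h4 := norm_add_ge RH ρ hw
    have h5 : (w:ℂ) + 1 - ρ.1 ≠ 0 := norm_pos_iff.1 (h0.trans_le h4)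
    have h6 : 1 - ρ.1 ≠ 0 := norm_pos_iff.1 (by rw [norm_one_sub RH]; exact h0)
    rw [div_sub_div _ _ h5 h6, norm_mul, norm_div, norm_mul, norm_one_sub RH]
    have h7 : ‖(1 * (1 - ρ.1) - (w + 1 - ρ.1) * 1 : ℂ)‖ = w := by
      rw [show (1 * (1 - ρ.1) - (w + 1 - ρ.1) * 1 : ℂ) = -(w:ℂ) by ring]
      simp [abs_of_nonneg hw]
    rw [h7, aa]
    simp only [Complex.norm_real, Real.norm_of_nonneg (mm_nonneg ρ)]
    rw [← mul_div_assoc, ← mul_div_assoc, mul_comm w]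
    gcongr
    · exact mul_nonneg (mm_nonneg ρ) hw
    · nlinarith
  have h4 := hs.hasSum
  have h5 := h4.comp ZF_tendsto
  have h6 : Tendsto (fun n => ∑ ρ ∈ ZF n, (mm ρ : ℂ) * (1 / (w + 1 - ρ.1) - 1 / (1 - ρ.1))) atTop
      (𝓝 (logDeriv xi (w + 1) - logDeriv xi 1)) := by
    convert h3 using 2
    · rw [← Finset.sum_sub_distrib]
      exact Finset.sum_congr rfl fun ρ _ => by ring
    · ring
  rwa [tendsto_nhds_unique h5 h6] at h4

end
end SelbergAux

namespace SelbergAux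
section
open Complex Filter Topology MeasureTheory Set

lemma hasSum_of_eq {ι : Type*} {f g : ι → ℂ} {a : ℂ} (h : ∀ i, f i = g i) (hg : HasSum g a) : HasSum f a := by
  rwa [show f = g from funext h]

lemma hasSum_tele (j : ℕ) : HasSum (fun k : ℕ => (1 / (2 * k + 3) - 1 / (2 * k + 3 + 2 * j) : ℝ))
    (∑ i ∈ Finset.range j, 1 / (2 * i + 3 : ℝ)) := by
  induction j with
  | zero => simpa using hasSum_zero
  | succ j ih =>
    have h : HasSum (fun k : ℕ => (1 / (2 * k + 3 + 2 * j) - 1 / (2 * k + 3 + 2 * (j + 1)) : ℝ)) (1 / (2 * j + 3)) := by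
      rw [hasSum_iff_tendsto_nat_of_nonneg]
      · have e : ∀ n : ℕ, ∑ k ∈ Finset.range n, (1 / (2 * k + 3 + 2 * j) - 1 / (2 * k + 3 + 2 * (j + 1)) : ℝ)
            = 1 / (2 * j + 3) - 1 / (2 * n + 3 + 2 * j) := by
          intro n
          have := Finset.sum_range_sub' (fun k : ℕ => (1 / (2 * k + 3 + 2 * j) : ℝ)) n
          rw [show (1 / (2 * j + 3) - 1 / (2 * n + 3 + 2 * j) : ℝ) = 1 / (2 * (0:ℕ) + 3 + 2 * j) - 1 / (2 * n + 3 + 2 * j) by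
            congr 2; push_cast; ring]
          rw [← this]
          refine Finset.sum_congr rfl fun k _ => ?_
          push_cast
          congr 2
          ring
        simp only [e]
        have : Tendsto (fun n : ℕ => (1 / (2 * n + 3 + 2 * j) : ℝ)) atTop (𝓝 0) := by
          refine tendsto_const_nhds.div_atTop ?_
          apply tendsto_atTop_add_const_right
          apply tendsto_atTop_add_const_right
          exact (tendsto_natCast_atTop_atTop (R := ℝ)).const_mul_atTop (by norm_num)
        simpa using tendsto_const_nhds.sub this
      · intro k
        rw [sub_nonneg]
        apply one_div_le_one_div_of_le (by positivity)
        linarith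
    have h2 := ih.add h
    rw [Finset.sum_range_succ]
    convert h2 using 2 with k
    push_cast
    ring

lemma Gammaℝ_diff {s : ℂ} (h : 0 < s.re) : DifferentiableAt ℂ Gammaℝ s := by
  have h1 := differentiable_Gammaℝ_inv s
  have h2 := h1.inv (inv_ne_zero (Gammaℝ_ne_zero_of_re_pos h))
  have e : (fun s => (Gammaℝ s)⁻¹)⁻¹ = Gammaℝ := by ext; simp
  rwa [e] at h2

lemma logDeriv_Gammaℝ_add_two {s : ℂ} (h : 0 < s.re) :
    logDeriv Gammaℝ (s + 2) = logDeriv Gammaℝ s + 1 / s := by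
  have hs : s ≠ 0 := by rintro rfl; simp at h
  have h1 : logDeriv (fun z => Gammaℝ (z + 2)) s = logDeriv Gammaℝ (s + 2) := by
    rw [logDeriv_apply, logDeriv_apply, deriv_comp_add_const]
  have h2 : (fun z => Gammaℝ (z + 2)) =ᶠ[𝓝 s] fun z => Gammaℝ z * (z * (1 / 2 / Real.pi)) := by
    filter_upwards [eventually_re h] with z hz
    rw [Gammaℝ_add_two (by rintro rfl; simp at hz)]
    ring
  have hpi : (Real.pi : ℂ) ≠ 0 := by exact_mod_cast Real.pi_ne_zero
  rw [← h1, logDeriv_apply, h2.deriv_eq, h2.eq_of_nhds, ← logDeriv_apply (fun z => Gammaℝ z * (z * (1 / 2 / Real.pi))),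
    logDeriv_mul s (Gammaℝ_ne_zero_of_re_pos h) (by simp [hs]) (Gammaℝ_diff h) (by fun_prop)]
  rw [logDeriv_mul_const s _ (by simp)]
  simp [logDeriv_apply]

lemma logDeriv_Gammaℝ_odd (j : ℕ) :
    logDeriv Gammaℝ (2 * j + 1) + 1 / (2 * j + 1) = logDeriv Gammaℝ 1 + 1 + ((∑ i ∈ Finset.range j, 1 / (2 * i + 3 : ℝ) : ℝ) : ℂ) := by
  induction j with
  | zero => simp
  | succ j ih =>
    have h := logDeriv_Gammaℝ_add_two (s := 2 * j + 1) (by simp; positivity)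
    rw [Finset.sum_range_succ]
    push_cast at ih ⊢
    rw [show (2 * ((j:ℂ) + 1) + 1) = 2 * j + 1 + 2 by ring, h, ih]
    ring

lemma eta_diff {s : ℂ} (h : s ≠ 1) : HasDerivAt eta (riemannZeta s + (s - 1) * deriv riemannZeta s) s := by
  have h1 : HasDerivAt (fun z : ℂ => (z - 1) * riemannZeta z) (1 * riemannZeta s + (s - 1) * deriv riemannZeta s) s :=
    ((hasDerivAt_id s).sub_const 1).mul (differentiableAt_riemannZeta h).hasDerivAt
  rw [one_mul] at h1
  refine h1.congr_of_eventuallyEq ?_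
  filter_upwards [isOpen_ne.mem_nhds h] with z hz
  exact eta_of_ne hz

lemma logDeriv_xi_eq {s : ℂ} (h : 0 < s.re) (he : eta s ≠ 0) (hd : DifferentiableAt ℂ eta s) :
    logDeriv xi s = 1 / s + logDeriv Gammaℝ s + logDeriv eta s := by
  have hs : s ≠ 0 := by rintro rfl; simp at h
  have h2 : xi =ᶠ[𝓝 s] fun z => (z * Gammaℝ z) * eta z := by
    filter_upwards [eventually_re h] with z hz
    exact xi_eta hz
  have hG := Gammaℝ_ne_zero_of_re_pos h
  have hGd := Gammaℝ_diff h
  rw [logDeriv_apply, h2.deriv_eq, h2.eq_of_nhds, ← logDeriv_apply (fun z => (z * Gammaℝ z) * eta z),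
    logDeriv_mul (f := fun z => z * Gammaℝ z) s (mul_ne_zero hs hG) he (by fun_prop) hd, logDeriv_mul s hs hG (by fun_prop) hGd]
  simp [logDeriv_apply]

lemma Z_eq {j : ℕ} (hj : 1 ≤ j) : -deriv riemannZeta (2 * j + 1) / riemannZeta (2 * j + 1) =
    1 / (2 * j) - Real.eulerMascheroniConstant + ((∑ i ∈ Finset.range j, 1 / (2 * i + 3 : ℝ) : ℝ) : ℂ)
      - (logDeriv xi (2 * j + 1) - logDeriv xi 1) := by
  have hj' : (j:ℂ) ≠ 0 := by simp; omega
  have h1 : (2 * j + 1 : ℂ) ≠ 1 := by simpa using hj'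
  have hz : riemannZeta (2 * j + 1) ≠ 0 := riemannZeta_ne_zero_of_one_le_re (by simp)
  have hd := eta_diff h1
  have he : eta (2 * j + 1) ≠ 0 := by
    rw [eta_of_ne h1]; simp [hj', hz]
  have hd1 := hasDerivAt_eta_one
  rw [logDeriv_xi_eq (s := 2 * j + 1) (by simp; positivity) he hd.differentiableAt,
    logDeriv_xi_eq (s := 1) (by simp) (by simp [eta_one]) hd1.differentiableAt,
    logDeriv_apply eta, logDeriv_apply eta, hd.deriv, hd1.deriv, eta_one, eta_of_ne h1]
  have h2 := logDeriv_Gammaℝ_odd j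
  have h3 : (riemannZeta (2 * j + 1) + (2 * j + 1 - 1) * deriv riemannZeta (2 * j + 1)) / ((2 * j + 1 - 1) * riemannZeta (2 * j + 1))
     = 1 / (2 * j) + deriv riemannZeta (2 * j + 1) / riemannZeta (2 * j + 1) := by
    rw [add_sub_cancel_right]
    field_simp
  rw [h3]
  linear_combination h2

noncomputable def cc : ℂ := (∑' ρ : Zt, (mm ρ : ℂ) / (1 - ρ.1) ^ 2) + ∑' k : ℕ, (1 / (2 * k + 3 : ℂ) ^ 2)

lemma summable_mm (RH : RiemannHypothesis) : Summable (fun ρ : Zt => (mm ρ : ℂ) / (1 - ρ.1) ^ 2) := by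
  refine Summable.of_norm_bounded (hasSum_aa RH).summable fun ρ => ?_
  rw [norm_div, norm_pow, norm_one_sub RH, aa]
  simp [abs_of_nonneg (mm_nonneg ρ)]

lemma summable_odd : Summable (fun k : ℕ => (1 / (2 * k + 3 : ℝ) ^ 2)) := by
  have h := (summable_nat_add_iff 1).2 (Real.summable_one_div_nat_pow.2 (le_refl 2))
  refine Summable.of_nonneg_of_le (fun k => by positivity) (fun k => ?_) h
  push_cast
  apply one_div_le_one_div_of_le (by positivity)
  have : (0:ℝ) ≤ k := Nat.cast_nonneg k
  nlinarith

lemma summable_oddC : Summable (fun k : ℕ => (1 / (2 * k + 3 : ℂ) ^ 2)) := by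
  have := (Complex.hasSum_ofReal.2 summable_odd.hasSum).summable
  simpa using this

lemma Z_final (RH : RiemannHypothesis) {j : ℕ} (hj : 1 ≤ j) :
    (-deriv riemannZeta (2 * j + 1) / riemannZeta (2 * j + 1)) / (2 * j) ^ 2 = 
    1 / (2 * j) ^ 3 - Real.eulerMascheroniConstant * (1 / (2 * j) ^ 2) + cc * (1 / (2 * j))
     - (∑' ρ : Zt, (mm ρ : ℂ) / (1 - ρ.1) ^ 2 * (1 / (2 * j + (1 - ρ.1))))
     - (∑' k : ℕ, (1 / (2 * k + 3 : ℂ) ^ 2) * (1 / (2 * j + (2 * k + 3)))) := by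
  have hj' : (j:ℂ) ≠ 0 := by simp; omega
  have hA := PFsum RH (w := 2 * j) (by positivity)
  have hB := Complex.hasSum_ofReal.2 (hasSum_tele j)
  push_cast at hA hB
  have h1 : HasSum (fun ρ : Zt => (mm ρ : ℂ) / (1 - ρ.1) ^ 2 * (1 / (2 * j + (1 - ρ.1))))
     ((logDeriv xi (2 * j + 1) - logDeriv xi 1) * (1 / (2 * j) ^ 2) + (1 / (2 * j)) * ∑' ρ : Zt, (mm ρ : ℂ) / (1 - ρ.1) ^ 2) := by
    refine hasSum_of_eq (fun ρ => ?_) ((hA.mul_right (1 / (2 * j : ℂ) ^ 2)).add ((summable_mm RH).hasSum.mul_left (1 / (2 * j : ℂ))))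
    have h0 : 0 < ‖ρ.1‖ := norm_pos_iff.2 (Zt_ne_zero ρ)
    have h4 := norm_add_ge RH ρ (w := 2 * j) (by positivity)
    push_cast at h4
    have h5 : (2 * (j:ℂ)) + 1 - ρ.1 ≠ 0 := norm_pos_iff.1 (h0.trans_le h4)
    have h6 : 1 - ρ.1 ≠ 0 := norm_pos_iff.1 (by rw [norm_one_sub RH]; exact h0)
    rw [← add_sub_assoc]
    field_simp
    ring
  have h2 : HasSum (fun k : ℕ => (1 / (2 * k + 3 : ℂ) ^ 2) * (1 / (2 * j + (2 * k + 3))))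
     (-(∑ i ∈ Finset.range j, 1 / (2 * i + 3 : ℂ)) * (1 / (2 * j) ^ 2) + (1 / (2 * j)) * ∑' k : ℕ, (1 / (2 * k + 3 : ℂ) ^ 2)) := by
    refine hasSum_of_eq (fun k => ?_) ((hB.neg.mul_right (1 / (2 * j : ℂ) ^ 2)).add ((summable_oddC).hasSum.mul_left (1 / (2 * j : ℂ))))
    · have h5 : (2 * k + 3 : ℂ) ≠ 0 := by exact_mod_cast (by omega : 2 * k + 3 ≠ 0)
      have h6 : (2 * k + 3 + 2 * j : ℂ) ≠ 0 := by exact_mod_cast (by omega : 2 * k + 3 + 2 * j ≠ 0)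
      rw [add_comm (2 * (j:ℂ))]
      field_simp
      ring
  rw [h1.tsum_eq, h2.tsum_eq, Z_eq hj, cc]
  push_cast
  field_simp
  ring

end
end SelbergAux

namespace SelbergAux
section
open Complex Filter Topology MeasureTheory Set

/-- continuous on `[0,∞)`, of growth at most `exp u`, with Laplace transform `F`. -/
structure Good (f : ℝ → ℂ) (F : ℝ → ℂ) : Prop where
  cont : ContinuousOn f (Ici 0)
  bdd : ∃ C : ℝ, ∀ u : ℝ, 0 ≤ u → ‖f u‖ ≤ C * Real.exp u
  lap : ∀ w : ℝ, 2 ≤ w → ∫ u in Ioi (0:ℝ), f u * (Real.exp (-(w * u)) : ℂ) = F w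

lemma integrable_of {f : ℝ → ℂ} (hc : ContinuousOn f (Ici 0)) {C : ℝ} (hb : ∀ u : ℝ, 0 ≤ u → ‖f u‖ ≤ C * Real.exp u)
    {w : ℝ} (hw : 2 ≤ w) : IntegrableOn (fun u => f u * (Real.exp (-(w * u)) : ℂ)) (Ioi 0) := by
  have h1 : IntegrableOn (fun u => C * Real.exp (-(w - 1) * u)) (Ioi 0) :=
    (exp_neg_integrableOn_Ioi 0 (by linarith)).const_mul C
  refine Integrable.mono' h1 ?_ ?_
  · refine ContinuousOn.aestronglyMeasurable ?_ measurableSet_Ioi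
    exact (hc.mono Ioi_subset_Ici_self).mul (by fun_prop)
  · rw [ae_restrict_iff' measurableSet_Ioi]
    refine ae_of_all _ fun u (hu : 0 < u) => ?_
    rw [norm_mul, Complex.norm_real, Real.norm_of_nonneg (Real.exp_pos _).le]
    calc _ ≤ C * Real.exp u * Real.exp (-(w * u)) := by
          gcongr; exact hb u hu.le
      _ = _ := by rw [mul_assoc, ← Real.exp_add]; congr 2; ring

lemma Good.integrable {f F} (h : Good f F) {w : ℝ} (hw : 2 ≤ w) :
    IntegrableOn (fun u => f u * (Real.exp (-(w * u)) : ℂ)) (Ioi 0) := by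
  obtain ⟨C, hC⟩ := h.bdd
  exact integrable_of h.cont hC hw

lemma Good.add {f g F G} (hf : Good f F) (hg : Good g G) : Good (fun u => f u + g u) (fun w => F w + G w) where
  cont := hf.cont.add hg.cont
  bdd := by
    obtain ⟨C, hC⟩ := hf.bdd
    obtain ⟨D, hD⟩ := hg.bdd
    refine ⟨C + D, fun u hu => (norm_add_le _ _).trans ?_⟩
    rw [add_mul]; exact add_le_add (hC u hu) (hD u hu)
  lap := by
    intro w hw
    simp only [add_mul]
    rw [integral_add (hf.integrable hw) (hg.integrable hw), hf.lap w hw, hg.lap w hw]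

lemma Good.const_mul {f F} (hf : Good f F) (c : ℂ) : Good (fun u => c * f u) (fun w => c * F w) where
  cont := continuousOn_const.mul hf.cont
  bdd := by
    obtain ⟨C, hC⟩ := hf.bdd
    refine ⟨‖c‖ * C, fun u hu => ?_⟩
    rw [norm_mul, mul_assoc]; gcongr; exact hC u hu
  lap := by
    intro w hw
    simp only [mul_assoc]
    rw [integral_const_mul, hf.lap w hw]

lemma Good.tsum {ι : Type} [Countable ι] {f : ι → ℝ → ℂ} {F : ι → ℝ → ℂ} (h : ∀ i, Good (f i) (F i)) {b : ι → ℝ}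
    (hb : Summable b) (hfb : ∀ i u, 0 ≤ u → ‖f i u‖ ≤ b i * Real.exp u) :
    Good (fun u => ∑' i, f i u) (fun w => ∑' i, F i w) where
  cont := by
    have h1 : ContinuousOn (fun u => ∑' i, f i u * (Real.exp (-u) : ℂ)) (Ici 0) := by
      refine continuousOn_tsum (fun i => (h i).cont.mul (by fun_prop)) hb fun i u hu => ?_
      rw [norm_mul, Complex.norm_real, Real.norm_of_nonneg (Real.exp_pos _).le]
      calc _ ≤ b i * Real.exp u * Real.exp (-u) := by gcongr; exact hfb i u hu
        _ = _ := by rw [mul_assoc, ← Real.exp_add]; simp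
    have h2 : ContinuousOn (fun u : ℝ => (Real.exp u : ℂ)) (Ici 0) := by fun_prop
    refine (h1.mul h2).congr fun u hu => ?_
    simp only [tsum_mul_right, Pi.mul_apply]
    rw [mul_assoc, ← Complex.ofReal_mul, ← Real.exp_add]; simp
  bdd := by
    refine ⟨∑' i, b i, fun u hu => ?_⟩
    have hs : Summable fun i => ‖f i u‖ := Summable.of_nonneg_of_le (fun _ => norm_nonneg _) (fun i => hfb i u hu) (hb.mul_right _)
    refine (norm_tsum_le_tsum_norm hs).trans ?_
    rw [← tsum_mul_right]
    exact hs.tsum_le_tsum (fun i => hfb i u hu) (hb.mul_right _)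
  lap := by
    intro w hw
    have hI : ∫ u in Ioi (0:ℝ), Real.exp (-(w - 1) * u) = 1 / (w - 1) := by
      rw [integral_exp_mul_Ioi (by linarith)]; simp [neg_div]
      rw [← neg_sub w 1]; rw [inv_neg, neg_neg]
    have h1 := hasSum_integral_of_summable_integral_norm (μ := volume.restrict (Ioi (0:ℝ)))
      (F := fun i u => f i u * (Real.exp (-(w * u)) : ℂ)) (fun i => (h i).integrable hw) (by
        refine Summable.of_nonneg_of_le (fun i => integral_nonneg fun _ => norm_nonneg _) (fun i => ?_) (hb.mul_right (1 / (w - 1)))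
        rw [← hI, ← integral_const_mul]
        refine integral_mono_of_nonneg (ae_of_all _ fun _ => norm_nonneg _) ((exp_neg_integrableOn_Ioi 0 (by linarith)).const_mul _) ?_
        · rw [EventuallyLE, ae_restrict_iff' measurableSet_Ioi]
          refine ae_of_all _ fun u (hu : 0 < u) => ?_
          rw [norm_mul, Complex.norm_real, Real.norm_of_nonneg (Real.exp_pos _).le]
          calc _ ≤ b i * Real.exp u * Real.exp (-(w * u)) := by
                gcongr; exact hfb i u hu.le
            _ = _ := by rw [mul_assoc, ← Real.exp_add]; congr 2; ring)
    simp only [tsum_mul_right] at h1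
    rw [← h1.tsum_eq]
    exact tsum_congr fun i => (h i).lap w hw

lemma good_exp {a : ℂ} (ha : 0 ≤ a.re) : Good (fun u => cexp (-(a * u))) (fun w => 1 / (w + a)) where
  cont := by fun_prop
  bdd := by
    refine ⟨1, fun u hu => ?_⟩
    rw [Complex.norm_exp, one_mul, Real.exp_le_exp]
    simp
    nlinarith [mul_nonneg ha hu]
  lap := by
    intro w hw
    have h := integral_exp_mul_complex_Ioi (a := -(w + a)) (by simp; linarith) 0
    rw [show (1 / (w + a) : ℂ) = - cexp (-(w + a) * (0:ℝ)) / (-(w + a)) by rw [neg_div_neg_eq]; simp, ← h]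
    refine setIntegral_congr_fun measurableSet_Ioi fun u _ => ?_
    simp only [Complex.ofReal_exp, ← Complex.exp_add]
    congr 1
    push_cast; ring

lemma good_one : Good (fun _ => 1) (fun w => 1 / w) := by
  have := good_exp (a := 0) (by simp)
  simpa using this

lemma lap_pow (n : ℕ) {w : ℝ} (hw : 0 < w) : ∫ u in Ioi (0:ℝ), u ^ n * Real.exp (-(w * u)) = n.factorial / w ^ (n + 1) := by
  have h := Real.integral_rpow_mul_exp_neg_mul_Ioi (a := n + 1) (r := w) (by positivity) hw
  rw [Real.Gamma_nat_eq_factorial] at h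
  have e : (1 / w) ^ ((n:ℝ) + 1) = 1 / w ^ (n + 1) := by
    rw [← Nat.cast_succ, Real.rpow_natCast, one_div_pow]
  rw [e] at h
  rw [show (n.factorial / w ^ (n + 1) : ℝ) = 1 / w ^ (n + 1) * n.factorial by ring, ← h]
  refine setIntegral_congr_fun measurableSet_Ioi fun u _ => ?_
  simp

lemma good_id : Good (fun u => (u : ℂ)) (fun w => 1 / w ^ 2) where
  cont := by fun_prop
  bdd := by
    refine ⟨1, fun u hu => ?_⟩
    rw [Complex.norm_real, Real.norm_of_nonneg hu]
    have := Real.add_one_le_exp u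
    linarith
  lap := by
    intro w hw
    have h := lap_pow 1 (w := w) (by linarith)
    simp only [← Complex.ofReal_mul]
    rw [integral_complex_ofReal]
    simp only [pow_one] at h
    rw [h]; simp

lemma good_sq : Good (fun u => (u : ℂ) ^ 2 / 2) (fun w => 1 / w ^ 3) where
  cont := by fun_prop
  bdd := by
    refine ⟨1, fun u hu => ?_⟩
    rw [norm_div, norm_pow, Complex.norm_real, Real.norm_of_nonneg hu]
    have := Real.quadratic_le_exp_of_nonneg hu
    simp
    linarith
  lap := by
    intro w hw
    have h := lap_pow 2 (w := w) (by linarith)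
    have : ∀ u : ℝ, (u:ℂ) ^ 2 / 2 * (Real.exp (-(w * u)) : ℂ) = ((1 / 2 * (u ^ 2 * Real.exp (-(w * u))) : ℝ) : ℂ) := by
      intro u; push_cast; ring
    simp only [this]
    rw [integral_complex_ofReal, integral_const_mul, h]; simp [Nat.factorial]; ring

lemma good_max {l : ℝ} (hl : 0 ≤ l) : Good (fun u => ((max 0 (u - l) : ℝ) : ℂ)) (fun w => Real.exp (-(w * l)) / w ^ 2) where
  cont := by fun_prop
  bdd := by
    refine ⟨1, fun u hu => ?_⟩
    rw [Complex.norm_real, Real.norm_of_nonneg (le_max_left _ _)]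
    have := Real.add_one_le_exp u
    rw [one_mul]
    apply max_le <;> linarith
  lap := by
    intro w hw
    simp only [← Complex.ofReal_mul]
    rw [integral_complex_ofReal]
    have h1 : ∫ u in Ioi (0:ℝ), max 0 (u - l) * Real.exp (-(w * u)) = ∫ u in Ioi l, max 0 (u - l) * Real.exp (-(w * u)) := by
      apply setIntegral_eq_of_subset_of_forall_sdiff_eq_zero measurableSet_Ioi (Ioi_subset_Ioi hl)
      intro u hu
      have : u ≤ l := not_lt.1 hu.2
      rw [max_eq_left (by linarith), zero_mul]
    have h2 := (measurePreserving_add_right volume l).setIntegral_preimage_emb (MeasurableEquiv.addRight l).measurableEmbedding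
      (fun u => max 0 (u - l) * Real.exp (-(w * u))) (Ioi l)
    rw [h1, ← h2]
    have h3 : (fun x : ℝ => x + l) ⁻¹' Ioi l = Ioi 0 := by ext; simp
    rw [h3]
    have h4 : ∫ x in Ioi (0:ℝ), max 0 (x + l - l) * Real.exp (-(w * (x + l))) = ∫ x in Ioi (0:ℝ), Real.exp (-(w * l)) * (x ^ 1 * Real.exp (-(w * x))) := by
      refine setIntegral_congr_fun measurableSet_Ioi fun u (hu : 0 < u) => ?_
      simp only [add_sub_cancel_right, max_eq_right hu.le]
      rw [show -(w * (u + l)) = -(w * l) + -(w * u) by ring, Real.exp_add]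
      ring
    rw [h4, integral_const_mul, lap_pow 1 (by linarith)]
    push_cast
    simp [div_eq_mul_inv]

end
end SelbergAux

namespace SelbergAux
section
open Complex Filter Topology MeasureTheory Set

lemma uniq_real {D : ℝ → ℝ} (hc : ContinuousOn D (Ici 0)) {C : ℝ} (hC : ∀ u : ℝ, 0 ≤ u → |D u| ≤ C * Real.exp u)
    (hI : ∀ j : ℕ, 2 ≤ j → ∫ u in Ioi (0:ℝ), D u * Real.exp (-((2 * j : ℝ) * u)) = 0) : ∀ u, 0 < u → D u = 0 := by
  have hIntAux : ∀ (f : ℝ → ℝ), ContinuousOn f (Ici 0) → (∃ K : ℝ, ∀ u, 0 ≤ u → |f u| ≤ K * Real.exp u) → ∀ w : ℝ, 2 ≤ w →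
      IntegrableOn (fun u => f u * Real.exp (-(w * u))) (Ioi 0) := by
    rintro f hf ⟨K, hK⟩ w hw
    have := integrable_of (f := fun u => (f u : ℂ)) (C := K) (Complex.continuous_ofReal.comp_continuousOn hf)
      (fun u hu => by simpa using hK u hu) hw
    have := this.re
    rw [IntegrableOn]
    simpa [← Complex.ofReal_mul, ← Complex.ofReal_neg, ← Complex.ofReal_exp] using this
  have hC0 : 0 ≤ C := by
    have := (abs_nonneg _).trans (hC 0 le_rfl)
    simpa using this
  set h : ℝ → ℝ := fun t => if t ≤ 0 then 0 else D (-(Real.log t) / 2) * t with hh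
  have hexp : ∀ u : ℝ, h (Real.exp (-(2 * u))) = D u * Real.exp (-(2 * u)) := by
    intro u
    have := Real.exp_pos (-(2 * u))
    simp only [hh, not_le.2 this, if_false, Real.log_exp]
    congr 2; ring
  have hcont : ContinuousOn h (Icc 0 1) := by
    intro t ht
    rcases ht.1.eq_or_lt with h0 | h0
    · subst h0
      have hz : h 0 = 0 := by simp [hh]
      rw [ContinuousWithinAt, hz]
      have h1 : Tendsto (fun t : ℝ => C * Real.sqrt t) (𝓝[Icc 0 1] 0) (𝓝 0) := by
        have : Continuous fun t : ℝ => C * Real.sqrt t := by fun_prop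
        have := this.tendsto 0
        simp only [Real.sqrt_zero, mul_zero] at this
        exact this.mono_left nhdsWithin_le_nhds
      refine squeeze_zero_norm' ?_ h1
      filter_upwards [self_mem_nhdsWithin] with t ht
      rcases ht.1.eq_or_lt with h0 | h0
      · subst h0; simp [hz]
      · simp only [hh, not_le.2 h0, if_false, norm_mul, Real.norm_eq_abs, abs_of_pos h0]
        have hl : 0 ≤ -(Real.log t) / 2 := by
          have := Real.log_nonpos ht.1 ht.2; linarith
        calc _ ≤ C * Real.exp (-(Real.log t) / 2) * t := by gcongr; exact hC _ hl
          _ = C * (Real.exp (-(Real.log t) / 2) * Real.exp (Real.log t)) := by rw [Real.exp_log h0]; ring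
          _ = C * Real.exp (Real.log t / 2) := by rw [← Real.exp_add]; congr 2; ring
          _ = C * Real.sqrt t := by
            rw [Real.exp_half, Real.exp_log h0]
          _ ≤ _ := le_rfl
    · have h2 : ContinuousOn (fun t => D (-(Real.log t) / 2) * t) (Ioc 0 1) := by
        refine ContinuousOn.mul (hc.comp (f := fun t => -(Real.log t) / 2) ?_ ?_) continuousOn_id
        · exact ((Real.continuousOn_log.mono (fun t ht => ht.1.ne')).neg).div_const 2
        · intro t ht
          have := Real.log_nonpos ht.1.le ht.2
          simp only [mem_Ici]; linarith
      have h3 : ContinuousWithinAt h (Ioc 0 1) t := by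
        refine (h2.congr fun s hs => ?_) t ⟨h0, ht.2⟩
        simp only [hh, not_le.2 hs.1, if_false]
      refine h3.mono_of_mem_nhdsWithin ?_
      rw [mem_nhdsWithin]
      exact ⟨Ioi 0, isOpen_Ioi, h0, fun s hs => ⟨hs.1, hs.2.2⟩⟩
  set I := ∫ u in Ioi (0:ℝ), (D u ^ 2 * Real.exp (-(2 * u))) * Real.exp (-(4 * u)) with hIdef
  set K := ∫ u in Ioi (0:ℝ), |D u| * Real.exp (-(4 * u)) with hKdef
  have hDint : ∀ w : ℝ, 2 ≤ w → IntegrableOn (fun u => D u * Real.exp (-(w * u))) (Ioi 0) := hIntAux D hc ⟨C, hC⟩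
  have hKint : IntegrableOn (fun u => |D u| * Real.exp (-(4 * u))) (Ioi 0) :=
    hIntAux (fun u => |D u|) hc.abs ⟨C, by simpa using hC⟩ 4 (by norm_num)
  have hIint : IntegrableOn (fun u => (D u ^ 2 * Real.exp (-(2 * u))) * Real.exp (-(4 * u))) (Ioi 0) := by
    refine hIntAux (fun u => D u ^ 2 * Real.exp (-(2 * u))) ((hc.pow 2).mul (by fun_prop)) ⟨C ^ 2, fun u hu => ?_⟩ 4 (by norm_num)
    rw [abs_mul, abs_pow, abs_of_pos (Real.exp_pos _)]
    calc _ ≤ (C * Real.exp u) ^ 2 * Real.exp (-(2 * u)) := by gcongr; exact hC u hu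
      _ = C ^ 2 * (Real.exp u ^ 2 * Real.exp (-(2 * u))) := by ring
      _ = C ^ 2 * 1 := by rw [← Real.exp_nat_mul, ← Real.exp_add]; simp
      _ ≤ _ := by gcongr; exact Real.one_le_exp hu
  have hIle : ∀ ε : ℝ, 0 < ε → I ≤ ε * K := by
    intro ε hε
    obtain ⟨p, hp⟩ := exists_polynomial_near_of_continuousOn 0 1 h hcont ε hε
    have hterm : ∀ i : ℕ, ∀ u : ℝ, D u * Real.exp (-(4 * u)) * (p.coeff i * Real.exp (-(2 * u)) ^ i)
        = p.coeff i * (D u * Real.exp (-((2 * (i + 2 : ℕ) : ℝ) * u))) := by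
      intro i u
      rw [← Real.exp_nat_mul]
      have : Real.exp (-((2 * (i + 2 : ℕ) : ℝ) * u)) = Real.exp (-(4 * u)) * Real.exp (i * -(2 * u)) := by
        rw [← Real.exp_add]; congr 1; push_cast; ring
      rw [this]; ring
    have hpi : ∀ i : ℕ, IntegrableOn (fun u => p.coeff i * (D u * Real.exp (-((2 * (i + 2 : ℕ) : ℝ) * u)))) (Ioi 0) :=
      fun i => (hDint _ (by push_cast; have : (0:ℝ) ≤ i := Nat.cast_nonneg i; linarith)).const_mul _
    have hpeq : ∀ u : ℝ, D u * Real.exp (-(4 * u)) * p.eval (Real.exp (-(2 * u))) =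
        ∑ i ∈ Finset.range (p.natDegree + 1), p.coeff i * (D u * Real.exp (-((2 * (i + 2 : ℕ) : ℝ) * u))) := by
      intro u
      rw [Polynomial.eval_eq_sum_range, Finset.mul_sum]
      exact Finset.sum_congr rfl fun i _ => hterm i u
    have hpint : IntegrableOn (fun u => D u * Real.exp (-(4 * u)) * p.eval (Real.exp (-(2 * u)))) (Ioi 0) := by
      simp only [hpeq]
      exact integrable_finsetSum _ fun i _ => hpi i
    have hp0 : ∫ u in Ioi (0:ℝ), D u * Real.exp (-(4 * u)) * p.eval (Real.exp (-(2 * u))) = 0 := by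
      simp only [hpeq]
      rw [integral_finsetSum _ fun i _ => hpi i]
      refine Finset.sum_eq_zero fun i _ => ?_
      rw [integral_const_mul, hI (i + 2) (by omega), mul_zero]
    rw [← sub_zero I, ← hp0, hIdef, ← integral_sub hIint hpint, hKdef, ← integral_const_mul]
    refine setIntegral_mono_on (hIint.sub hpint) (hKint.const_mul _) measurableSet_Ioi fun u (hu : 0 < u) => ?_
    have h1 := hp (Real.exp (-(2 * u))) ⟨(Real.exp_pos _).le, Real.exp_le_one_iff.2 (by linarith)⟩
    rw [hexp] at h1
    have h2 : D u ^ 2 * Real.exp (-(2 * u)) * Real.exp (-(4 * u)) - D u * Real.exp (-(4 * u)) * p.eval (Real.exp (-(2 * u)))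
      = -(D u * Real.exp (-(4 * u)) * (p.eval (Real.exp (-(2 * u))) - D u * Real.exp (-(2 * u)))) := by ring
    rw [h2]
    refine (neg_le_abs _).trans ?_
    rw [abs_mul, abs_mul, abs_of_pos (Real.exp_pos _), mul_comm ε]
    gcongr
  have hK0 : 0 ≤ K := integral_nonneg fun u => by positivity
  have hI0 : I = 0 := by
    apply le_antisymm
    · refine le_of_forall_pos_le_add fun δ hδ => ?_
      have := hIle (δ / (K + 1)) (by positivity)
      rw [zero_add]
      refine this.trans ?_
      rw [div_mul_eq_mul_div, div_le_iff₀ (by positivity)]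
      nlinarith
    · exact integral_nonneg fun u => by positivity
  rw [hIdef, integral_eq_zero_iff_of_nonneg (fun u => by positivity) hIint] at hI0
  have h5 : EqOn (fun u => (D u ^ 2 * Real.exp (-(2 * u))) * Real.exp (-(4 * u))) 0 (Ioi 0) := by
    refine Measure.eqOn_open_of_ae_eq hI0 isOpen_Ioi ?_ continuousOn_const
    exact (((hc.mono Ioi_subset_Ici_self).pow 2).mul (by fun_prop)).mul (by fun_prop)
  intro u hu
  have := h5 hu
  simpa using this

lemma Good.uniq {f F} (h : Good f F) (hF : ∀ j : ℕ, 2 ≤ j → F (2 * j) = 0) {u : ℝ} (hu : 0 < u) : (f u).re = 0 := by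
  obtain ⟨C, hC⟩ := h.bdd
  refine uniq_real (D := fun u => (f u).re) (C := C) (continuous_re.comp_continuousOn h.cont)
    (fun u hu => (Complex.abs_re_le_norm _).trans (hC u hu)) ?_ u hu
  intro j hj
  have hj' : (2:ℝ) ≤ 2 * j := by
    have : (2:ℝ) ≤ j := by exact_mod_cast hj
    linarith
  have h1 := h.lap (2 * j) hj'
  have h2 := integral_re (h.integrable hj')
  have h3 : ∀ u, RCLike.re (f u * (Real.exp (-(2 * j * u)) : ℂ)) = (f u).re * Real.exp (-(2 * j * u)) := by
    intro u
    exact Complex.re_mul_ofReal _ _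
  simp only [h3] at h2
  rw [h2, h1, hF j hj]
  simp

end
end SelbergAux

namespace SelbergAux
section
open Complex Filter Topology MeasureTheory Set

open ArithmeticFunction in
lemma summable_Λ : Summable (fun n : ℕ => Λ n / (n:ℝ) ^ 2) := by
  have h := LSeriesSummable_vonMangoldt (s := 2) (by simp)
  have h2 := h.norm
  refine h2.congr fun n => ?_
  rcases eq_or_ne n 0 with rfl | hn
  · simp
  · rw [LSeries.term_of_ne_zero hn]
    simp [abs_of_nonneg (vonMangoldt_nonneg (n := n))]

open ArithmeticFunction in
lemma good_S : Good (fun u => ∑' n : ℕ, ((Λ n / n : ℝ) : ℂ) * ((max 0 (u - Real.log n) : ℝ) : ℂ))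
    (fun w => -deriv riemannZeta (w + 1) / riemannZeta (w + 1) / w ^ 2) := by
  have h := Good.tsum (fun n : ℕ => (good_max (Real.log_natCast_nonneg n)).const_mul ((Λ n / n : ℝ) : ℂ)) summable_Λ
    (by
      intro n u hu
      rw [← Complex.ofReal_mul, Complex.norm_real, norm_mul, Real.norm_of_nonneg (le_max_left _ _),
        Real.norm_of_nonneg (div_nonneg vonMangoldt_nonneg (Nat.cast_nonneg _))]
      rcases Nat.eq_zero_or_pos n with rfl | hn
      · simp
      have hn' : (0:ℝ) < n := by exact_mod_cast hn
      have h1 : max 0 (u - Real.log n) ≤ Real.exp u / n := by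
        have h2 := Real.add_one_le_exp (u - Real.log n)
        rw [Real.exp_sub, Real.exp_log hn'] at h2
        apply max_le
        · positivity
        · linarith
      calc _ ≤ Λ n / n * (Real.exp u / n) :=
            mul_le_mul_of_nonneg_left h1 (div_nonneg vonMangoldt_nonneg (Nat.cast_nonneg _))
        _ = _ := by ring)
  refine ⟨h.cont, h.bdd, fun w hw => ?_⟩
  rw [h.lap w hw, ← LSeries_vonMangoldt_eq_deriv_riemannZeta_div (by simp; linarith), LSeries, ← tsum_div_const]
  refine tsum_congr fun n => ?_
  rcases eq_or_ne n 0 with rfl | hn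
  · simp
  have hn' : (n:ℂ) ≠ 0 := by exact_mod_cast hn
  rw [LSeries.term_of_ne_zero hn, Complex.cpow_add _ _ hn', Complex.cpow_one, Complex.cpow_def_of_ne_zero hn', ← Complex.natCast_log]
  push_cast
  rw [Complex.exp_neg, mul_comm (w:ℂ)]
  have := Complex.exp_ne_zero ((Real.log n : ℂ) * w)
  field_simp

noncomputable def Zs (u : ℝ) : ℂ := ∑' ρ : Zt, (mm ρ : ℂ) / (1 - ρ.1) ^ 2 * cexp (-((1 - ρ.1) * u))
noncomputable def Ts (u : ℝ) : ℂ := ∑' k : ℕ, (1 / (2 * k + 3 : ℂ) ^ 2) * cexp (-((2 * k + 3 : ℂ) * u))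

lemma Zs_term (RH : RiemannHypothesis) (ρ : Zt) (u : ℝ) : 
    ‖(mm ρ : ℂ) / (1 - ρ.1) ^ 2 * cexp (-((1 - ρ.1) * u))‖ = aa ρ * Real.exp (-(u / 2)) := by
  rw [norm_mul, norm_div, norm_pow, norm_one_sub RH, Complex.norm_exp, Complex.norm_real, Real.norm_of_nonneg (mm_nonneg ρ), aa]
  congr 2
  have := xi_zero_re RH ρ.2
  simp [this]
  ring

lemma Zs_bound (RH : RiemannHypothesis) (u : ℝ) : ‖Zs u‖ ≤ 2 * |Bconst| * Real.exp (-(u / 2)) := by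
  have h := tsum_of_norm_bounded ((hasSum_aa RH).mul_right (Real.exp (-(u / 2)))) (fun ρ => (Zs_term RH ρ u).le)
  refine h.trans ?_
  refine mul_le_mul_of_nonneg_right ?_ (Real.exp_pos _).le
  have := neg_le_abs Bconst
  linarith

lemma Ts_term (k : ℕ) (u : ℝ) : 
    ‖(1 / (2 * k + 3 : ℂ) ^ 2) * cexp (-((2 * k + 3 : ℂ) * u))‖ = 1 / (2 * k + 3 : ℝ) ^ 2 * Real.exp (-((2 * k + 3) * u)) := by
  have : ((1 / (2 * k + 3 : ℂ) ^ 2) * cexp (-((2 * k + 3 : ℂ) * u))) = ((1 / (2 * k + 3 : ℝ) ^ 2 * Real.exp (-((2 * k + 3) * u)) : ℝ) : ℂ) := by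
    push_cast; rfl
  rw [this, Complex.norm_real, Real.norm_of_nonneg (by positivity)]

lemma Ts_bound {u : ℝ} (hu : 0 < u) : ‖Ts u‖ ≤ 1 / 9 * (1 / (Real.exp u ^ 3 - Real.exp u)) := by
  have hX : 1 < Real.exp u := Real.one_lt_exp_iff.2 hu
  have hr : Real.exp (-(2 * u)) < 1 := Real.exp_lt_one_iff.2 (by linarith)
  have hg := (hasSum_geometric_of_lt_one (Real.exp_pos _).le hr).mul_left (1 / 9 * Real.exp (-(3 * u)))
  have h := tsum_of_norm_bounded hg (f := fun k : ℕ => (1 / (2 * k + 3 : ℂ) ^ 2) * cexp (-((2 * k + 3 : ℂ) * u))) (fun k => by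
    rw [Ts_term, ← Real.exp_nat_mul, mul_assoc, ← Real.exp_add]
    have e : Real.exp (-((2 * k + 3) * u)) = Real.exp (-(3 * u) + k * -(2 * u)) := by congr 1; ring
    rw [e]
    gcongr
    have : (0:ℝ) ≤ k := Nat.cast_nonneg k
    nlinarith)
  refine h.trans (le_of_eq ?_)
  rw [mul_assoc]
  congr 1
  have e3 : Real.exp (-(3 * u)) = 1 / Real.exp u ^ 3 := by
    rw [Real.exp_neg, ← Real.exp_nat_mul]; push_cast; rw [one_div]
  have e2 : Real.exp (-(2 * u)) = 1 / Real.exp u ^ 2 := by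
    rw [Real.exp_neg, ← Real.exp_nat_mul]; push_cast; rw [one_div]
  rw [e3, e2]
  have hp := Real.exp_pos u
  have h1 : Real.exp u ^ 2 - 1 ≠ 0 := by nlinarith
  have h2 : Real.exp u ^ 3 - Real.exp u ≠ 0 := by
    rw [show Real.exp u ^ 3 - Real.exp u = Real.exp u * (Real.exp u ^ 2 - 1) by ring]
    exact mul_ne_zero hp.ne' h1
  have h3 : 1 - 1 / Real.exp u ^ 2 ≠ 0 := by
    rw [one_sub_div (by positivity)]
    exact div_ne_zero h1 (by positivity)
  rw [← div_eq_mul_inv, div_div, mul_sub]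
  congr 1
  field_simp

lemma good_Zs (RH : RiemannHypothesis) : Good Zs (fun w => ∑' ρ : Zt, (mm ρ : ℂ) / (1 - ρ.1) ^ 2 * (1 / (w + (1 - ρ.1)))) := by
  refine Good.tsum (ι := Zt) (fun ρ => (good_exp (a := 1 - ρ.1) ?_).const_mul _) (hasSum_aa RH).summable ?_
  · have := xi_zero_re RH ρ.2
    simp [this]; norm_num
  · intro ρ u hu
    rw [Zs_term RH]
    gcongr
    · exact aa_nonneg ρ
    · linarith

lemma good_Ts : Good Ts (fun w => ∑' k : ℕ, (1 / (2 * k + 3 : ℂ) ^ 2) * (1 / (w + (2 * k + 3)))) := by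
  refine Good.tsum (fun k => (good_exp (a := 2 * k + 3) ?_).const_mul _) summable_odd ?_
  · simp; positivity
  · intro k u hu
    rw [Ts_term]
    gcongr
    have : (0:ℝ) ≤ k := Nat.cast_nonneg k
    nlinarith [mul_nonneg this hu]

open ArithmeticFunction in
lemma explicit (RH : RiemannHypothesis) {u : ℝ} (hu : 0 < u) {N : ℕ} (hN : Real.exp u < N + 1) :
    ∑ n ∈ Finset.Icc 1 N, Λ n / n * max 0 (u - Real.log n) =
      u ^ 2 / 2 - Real.eulerMascheroniConstant * u + cc.re - (Zs u).re - (Ts u).re := by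
  have hg := ((((good_S.add (good_sq.const_mul (-1))).add (good_id.const_mul (Real.eulerMascheroniConstant : ℂ))).add
    (good_one.const_mul (-cc))).add (good_Zs RH)).add good_Ts
  have h := hg.uniq (by
    intro j hj
    have := Z_final RH (j := j) (by omega)
    push_cast
    rw [this]
    ring) hu
  have e : ∑' n : ℕ, ((Λ n / n : ℝ) : ℂ) * ((max 0 (u - Real.log n) : ℝ) : ℂ) = ((∑ n ∈ Finset.Icc 1 N, Λ n / n * max 0 (u - Real.log n) : ℝ) : ℂ) := by
    rw [tsum_eq_sum (s := Finset.Icc 1 N)]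
    · push_cast; rfl
    · intro n hn
      rcases Nat.eq_zero_or_pos n with rfl | hn0
      · simp
      have hn1 : N + 1 ≤ n := by
        simp at hn; omega
      have hn2 : (N:ℝ) + 1 ≤ n := by exact_mod_cast hn1
      have : u ≤ Real.log n := by
        rw [Real.le_log_iff_exp_le (by exact_mod_cast hn0)]; linarith
      rw [max_eq_left (by linarith)]
      simp
  simp only [e] at h
  have hsq : ((u:ℂ) ^ 2 / 2) = ((u ^ 2 / 2 : ℝ) : ℂ) := by push_cast; rfl
  simp only [hsq] at h
  simp only [Complex.add_re, Complex.ofReal_re, Complex.re_mul_ofReal, Complex.neg_re, Complex.one_re, mul_one] at h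
  linarith

end
end SelbergAux
open SelbergAux

open scoped Classical in
/-- Assuming the Riemann hypothesis, for real `x, y ≥ 2`, with
`Λ_{x,y}(n) = Λ(n)` for `n ≤ x` and `Λ_{x,y}(n) = Λ(n) log(xy/n)/log y` for `x < n ≤ xy`,
`Σ_{n ≤ xy} Λ_{x,y}(n)/n = log x − γ + (log y)/2 + E₁ + E₂` with
`|E₁| ≤ 2|B|(√y + 1)/(√(xy) log y)` and `|E₂| ≤ (1/9)(1/(x³−x) + 1/((xy)³−xy))/log y`. -/
theorem selberg_weighted_sum (RH : RiemannHypothesis) (x y : ℝ) (hx : 2 ≤ x) (hy : 2 ≤ y) :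
    ∃ E₁ E₂ : ℝ,
      |E₁| ≤ 2 * |Bconst| * (Real.sqrt y + 1) / (Real.sqrt (x * y) * Real.log y) ∧
      |E₂| ≤ (1 / 9) * ((1 / (x ^ 3 - x) + 1 / ((x * y) ^ 3 - x * y)) / Real.log y) ∧
      ∑ n ∈ Finset.Icc 1 ⌊x * y⌋₊,
          (if (n : ℝ) ≤ x then ArithmeticFunction.vonMangoldt n
            else ArithmeticFunction.vonMangoldt n * Real.log (x * y / n) / Real.log y) / n
        = Real.log x - Real.eulerMascheroniConstant + Real.log y / 2 + E₁ + E₂ := by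
  have hx0 : 0 < x := by linarith
  have hy0 : 0 < y := by linarith
  have hxy0 : 0 < x * y := by positivity
  have hxy : x ≤ x * y := by nlinarith
  have hly : 0 < Real.log y := Real.log_pos (by linarith)
  have hlx : 0 < Real.log x := Real.log_pos (by linarith)
  have hlxy : Real.log (x * y) = Real.log x + Real.log y := Real.log_mul hx0.ne' hy0.ne'
  have hN := Nat.lt_floor_add_one (x * y)
  have h1 := explicit RH (u := Real.log (x * y)) (by linarith) (N := ⌊x * y⌋₊) (by rwa [Real.exp_log hxy0])
  have h2 := explicit RH (u := Real.log x) hlx (N := ⌊x * y⌋₊) (by rw [Real.exp_log hx0]; linarith)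
  have hsum : ∑ n ∈ Finset.Icc 1 ⌊x * y⌋₊,
          (if (n : ℝ) ≤ x then ArithmeticFunction.vonMangoldt n
            else ArithmeticFunction.vonMangoldt n * Real.log (x * y / n) / Real.log y) / n
       = (∑ n ∈ Finset.Icc 1 ⌊x * y⌋₊, ArithmeticFunction.vonMangoldt n / n * max 0 (Real.log (x * y) - Real.log n)
         - ∑ n ∈ Finset.Icc 1 ⌊x * y⌋₊, ArithmeticFunction.vonMangoldt n / n * max 0 (Real.log x - Real.log n)) / Real.log y := by
    rw [← Finset.sum_sub_distrib, Finset.sum_div]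
    refine Finset.sum_congr rfl fun n hn => ?_
    rw [Finset.mem_Icc] at hn
    have hn0 : (0:ℝ) < n := by exact_mod_cast hn.1
    have hn1 : (n:ℝ) ≤ x * y := (Nat.le_floor_iff hxy0.le).1 hn.2
    have hn2 : Real.log n ≤ Real.log (x * y) := Real.log_le_log hn0 hn1
    rw [max_eq_right (by linarith)]
    split_ifs with hnx
    · have hn3 : Real.log n ≤ Real.log x := Real.log_le_log hn0 hnx
      rw [max_eq_right (by linarith), hlxy]
      field_simp
      ring
    · have hn3 : Real.log x ≤ Real.log n := Real.log_le_log hx0 (not_le.1 hnx).le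
      rw [max_eq_left (by linarith), Real.log_div hxy0.ne' hn0.ne']
      field_simp
      ring
  refine ⟨((Zs (Real.log x)).re - (Zs (Real.log (x * y))).re) / Real.log y,
    ((Ts (Real.log x)).re - (Ts (Real.log (x * y))).re) / Real.log y, ?_, ?_, ?_⟩
  · have b1 := (Complex.abs_re_le_norm _).trans (Zs_bound RH (Real.log x))
    have b2 := (Complex.abs_re_le_norm _).trans (Zs_bound RH (Real.log (x * y)))
    have hs : ∀ z : ℝ, 0 < z → Real.exp (-(Real.log z / 2)) = 1 / Real.sqrt z := by
      intro z hz
      rw [Real.exp_neg, Real.exp_half, Real.exp_log hz, one_div]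
    rw [hs x hx0] at b1
    rw [hs _ hxy0] at b2
    rw [abs_div, abs_of_pos hly, ← div_div]
    gcongr
    refine (abs_sub _ _).trans ((add_le_add b1 b2).trans (le_of_eq ?_))
    have := Real.sqrt_pos.2 hx0
    have := Real.sqrt_pos.2 hy0
    rw [Real.sqrt_mul hx0.le]
    field_simp
  · have b1 := (Complex.abs_re_le_norm _).trans (Ts_bound hlx)
    have b2 := (Complex.abs_re_le_norm _).trans (Ts_bound (u := Real.log (x * y)) (by linarith))
    rw [Real.exp_log hx0] at b1
    rw [Real.exp_log hxy0] at b2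
    rw [abs_div, abs_of_pos hly, ← mul_div_assoc]
    gcongr
    refine (abs_sub _ _).trans ((add_le_add b1 b2).trans (le_of_eq ?_))
    ring
  · rw [hsum, h1, h2, hlxy]
    field_simp
    ring
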